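/- arXiv:1711.03513 — 2 statements merged into one kernel-verified Lean document; each statement's English description precedes it below -/
import Mathlib

section
/- (Matrix-slicing identity) Fix integers d ≥ 1, e ≥ 0 and p ≥ 1. Let ε_e : S_e → ℂ be the linear functional taking the value 1 on every monomial, define φ_p = id_{⋀^p S_d} ⊗ ε_e : ⋀^p S_d ⊗ S_e → ⋀^p S_d (so φ_p(m₁∧⋯∧m_p ⊗ f) = m₁∧⋯∧m_p on monomial pure tensors), and let δ_p : ⋀^p S_d → ⋀^{p−1} S_d be contraction with ε_d, so that δ_p(m₁∧⋯∧m_p) = Σ_{k=1}^p (−1)^k m₁∧⋯∧m̂_k∧⋯∧m_p on monomials. Then: (i) δ_p ∘ φ_p = φ_{p−1} ∘ ∂_p; and (ii) for every multidegree a ∈ ℕ³ with |a| = pd + e, the restriction of φ_p to the multidegree-a component of ⋀^p S_d ⊗ S_e is injective. Hence the restricted differential ∂_{p,a} is represented by the submatrix of δ_p on the monomial basis vectors of multidegree componentwise at most a whose complementary degree a minus their degree is a valid exponent vector. -/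
open scoped TensorProduct

set_option maxHeartbeats 2000000
set_option synthInstance.maxHeartbeats 1000000

noncomputable section

/-- The dimension (over `ℂ`) of a complex vector space, as a natural number. -/
def cdim (M : Type*) [AddCommMonoid M] [Module ℂ M] : ℕ := (Module.rank ℂ M).toNat

/-- The polynomial ring `S = ℂ[x₀,…,x_{N-1}]`. -/
abbrev PolyC (N : ℕ) : Type := MvPolynomial (Fin N) ℂ

/-- The space `S_e` of homogeneous polynomials of degree `e` (zero for `e < 0`). -/
def Sdeg (N : ℕ) (e : ℤ) : Submodule ℂ (PolyC N) :=
  if 0 ≤ e then MvPolynomial.homogeneousSubmodule (Fin N) ℂ e.toNat else ⊥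

/-- The monomial `x^σ`. -/
def monoC (N : ℕ) (σ : Fin N →₀ ℕ) : PolyC N := MvPolynomial.monomial σ (1 : ℂ)

/-- The wedge product `m₁ ∧ ⋯ ∧ mₙ` as an element of the `n`-th exterior power. -/
def wedgeE (R : Type*) [CommRing R] (M : Type*) [AddCommGroup M] [Module R M]
    (n : ℕ) (m : Fin n → M) : ↥(⋀[R]^n M) :=
  ⟨ExteriorAlgebra.ιMulti R n m, ExteriorAlgebra.ιMulti_range R n ⟨m, rfl⟩⟩

/-- The module `⋀^p S_d ⊗ S_e`. -/
abbrev KosModule (N : ℕ) (d : ℤ) (p : ℕ) (e : ℤ) : Type :=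
  (↥(⋀[ℂ]^p ↥(Sdeg N d))) ⊗[ℂ] ↥(Sdeg N e)

/-- `D` satisfies the defining formula of the Koszul differential
`∂_{p+1} : ⋀^{p+1} S_d ⊗ S_e → ⋀^p S_d ⊗ S_{e'}` (for `e' = e + d`), namely
`∂(m₁∧⋯∧m_{p+1} ⊗ f) = ∑ₖ (−1)ᵏ m₁∧⋯∧m̂ₖ∧⋯∧m_{p+1} ⊗ (mₖ·f)`; the equality is
stated after applying the (injective) inclusion `⋀^p S_d ⊗ S_{e'} → ⋀^p S_d ⊗ S`. -/
def IsKoszulDiff (N : ℕ) (d e e' : ℤ) (p : ℕ)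
    (D : KosModule N d (p + 1) e →ₗ[ℂ] KosModule N d p e') : Prop :=
  ∀ (m : Fin (p + 1) → ↥(Sdeg N d)) (f : ↥(Sdeg N e)),
    TensorProduct.map (LinearMap.id (R := ℂ) (M := ↥(⋀[ℂ]^p ↥(Sdeg N d)))) (Sdeg N e').subtype
        (D (wedgeE ℂ ↥(Sdeg N d) (p + 1) m ⊗ₜ[ℂ] f)) =
      ∑ k : Fin (p + 1), ((-1 : ℂ) ^ ((k : ℕ) + 1)) •
        (wedgeE ℂ ↥(Sdeg N d) p (fun i => m (Fin.succAbove k i)) ⊗ₜ[ℂ]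
          ((m k : PolyC N) * (f : PolyC N)))

/-- A family of maps of the shape of the Koszul differentials. -/
def KFam (N : ℕ) (d : ℤ) : Type :=
  ∀ (p : ℕ) (e e' : ℤ), KosModule N d (p + 1) e →ₗ[ℂ] KosModule N d p e'

/-- The family `D` consists of the Koszul differentials (at all meaningful degrees). -/
def IsKoszulFam (N : ℕ) (d : ℤ) (D : KFam N d) : Prop :=
  ∀ (p : ℕ) (e e' : ℤ), e' = e + d → IsKoszulDiff N d e e' p (D p e e')

/-- `dim K_{p,q}(ℙ^{N-1}, b; d)`: the dimension of the homology `ker ∂_p / im ∂_{p+1}` at the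
middle term of `⋀^{p+1} S_d ⊗ S_{b+(q-1)d} → ⋀^p S_d ⊗ S_{b+qd} → ⋀^{p-1} S_d ⊗ S_{b+(q+1)d}`,
where for `p = 0` the right-hand map is the zero map (the dimension of the quotient is expressed
as `dim ker − dim (im ⊓ ker)`, which agrees with it since all spaces here are
finite-dimensional). -/
def Kdim (N : ℕ) (d : ℤ) (D : KFam N d) (b : ℤ) : ℕ → ℤ → ℕ
  | 0, q =>
      cdim (KosModule N d 0 (b + q * d)) -
        cdim ↥(LinearMap.range (D 0 (b + (q - 1) * d) (b + q * d)))
  | p + 1, q =>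
      cdim ↥(LinearMap.ker (D p (b + q * d) (b + (q + 1) * d))) -
        cdim
          ↥(LinearMap.range (D (p + 1) (b + (q - 1) * d) (b + q * d)) ⊓
            LinearMap.ker (D p (b + q * d) (b + (q + 1) * d)))

/-- The multidegree-`a` component of `⋀^p S_d ⊗ S_e`: the span of the pure tensors
`m₁∧⋯∧m_p ⊗ f` with the `mᵢ` and `f` monomials of total multidegree `a`. -/
def KComp (N : ℕ) (d : ℤ) (p : ℕ) (e : ℤ) (a : Fin N →₀ ℕ) :
    Submodule ℂ (KosModule N d p e) :=
  Submodule.span ℂ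
    { x | ∃ (σ : Fin p → (Fin N →₀ ℕ)) (τ : Fin N →₀ ℕ)
        (hσ : ∀ i, monoC N (σ i) ∈ Sdeg N d) (hτ : monoC N τ ∈ Sdeg N e),
        (∑ i, σ i) + τ = a ∧
        x = wedgeE ℂ ↥(Sdeg N d) p (fun i => (⟨monoC N (σ i), hσ i⟩ : ↥(Sdeg N d))) ⊗ₜ[ℂ]
            (⟨monoC N τ, hτ⟩ : ↥(Sdeg N e)) }

/-- `dim K_{p,q}(ℙ^{N-1}, b; d)_a`: the dimension of the multidegree-`a` component of the
homology, i.e. of `(ker ∂_p ∩ (⋀^p S_d ⊗ S_{b+qd})_a) / (im ∂_{p+1} ∩ (⋀^p S_d ⊗ S_{b+qd})_a)`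
(again expressed as a difference of dimensions). -/
def KdimA (N : ℕ) (d : ℤ) (D : KFam N d) (b : ℤ) : ℕ → ℤ → (Fin N →₀ ℕ) → ℕ
  | 0, q, a =>
      cdim ↥(KComp N d 0 (b + q * d) a) -
        cdim
          ↥(LinearMap.range (D 0 (b + (q - 1) * d) (b + q * d)) ⊓ KComp N d 0 (b + q * d) a)
  | p + 1, q, a =>
      cdim
        ↥(LinearMap.ker (D p (b + q * d) (b + (q + 1) * d)) ⊓ KComp N d (p + 1) (b + q * d) a) -
        cdim
          ↥(LinearMap.range (D (p + 1) (b + (q - 1) * d) (b + q * d)) ⊓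
            (LinearMap.ker (D p (b + q * d) (b + (q + 1) * d)) ⊓
              KComp N d (p + 1) (b + q * d) a))

/-- Build a multidegree in `Fin 3 →₀ ℕ` from three exponents. -/
def mdeg3 (i j k : ℕ) : Fin 3 →₀ ℕ := Finsupp.equivFunOnFinite.symm ![i, j, k]

end

/-- The map `φ_p = id ⊗ ε_e : ⋀^p S_d ⊗ S_e → ⋀^p S_d` induced by a linear functional
`ε_e : S_e → ℂ` (via `⋀^p S_d ⊗ ℂ ≅ ⋀^p S_d`). -/
noncomputable def phiMap (N : ℕ) (d : ℤ) (p : ℕ) (e : ℤ) (ε : ↥(Sdeg N e) →ₗ[ℂ] ℂ) :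
    KosModule N d p e →ₗ[ℂ] ↥(⋀[ℂ]^p ↥(Sdeg N d)) :=
  (TensorProduct.rid ℂ (↥(⋀[ℂ]^p ↥(Sdeg N d)))).toLinearMap ∘ₗ
    TensorProduct.map LinearMap.id ε


section KoszulSlicingAux

open Module

/-- Membership of monomials in `Sdeg`. -/
lemma aux_mono_mem (N : ℕ) (e : ℤ) (he : 0 ≤ e) (σ : Fin N →₀ ℕ)
    (h : (σ.degree : ℤ) = e) : monoC N σ ∈ Sdeg N e := by
  rw [Sdeg, if_pos he, MvPolynomial.mem_homogeneousSubmodule]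
  exact MvPolynomial.isHomogeneous_monomial _ (by omega)

lemma aux_mono_ne (N : ℕ) (σ : Fin N →₀ ℕ) : monoC N σ ≠ 0 := by
  simp [monoC]

lemma aux_mul_mem (N : ℕ) (d e : ℤ) {f g : PolyC N} (hf : f ∈ Sdeg N d) (hg : g ∈ Sdeg N e) :
    f * g ∈ Sdeg N (e + d) := by
  unfold Sdeg at *
  by_cases hd : 0 ≤ d
  · by_cases he : 0 ≤ e
    · rw [if_pos hd] at hf
      rw [if_pos he] at hg
      rw [if_pos (by omega)]
      rw [MvPolynomial.mem_homogeneousSubmodule] at *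
      have := hf.mul hg
      rwa [show (e + d).toNat = d.toNat + e.toNat by omega]
    · rw [if_neg he] at hg
      rw [Submodule.mem_bot] at hg
      rw [hg, mul_zero]
      exact Submodule.zero_mem _
  · rw [if_neg hd] at hf
    rw [Submodule.mem_bot] at hf
    rw [hf, zero_mul]
    exact Submodule.zero_mem _

lemma aux_mono_mul (N : ℕ) (σ τ : Fin N →₀ ℕ) : monoC N σ * monoC N τ = monoC N (σ + τ) := by
  simp [monoC, MvPolynomial.monomial_mul]

lemma aux_mono_inj (N : ℕ) {σ τ : Fin N →₀ ℕ} (h : monoC N σ = monoC N τ) : σ = τ :=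
  MvPolynomial.monomial_left_injective (one_ne_zero) h

/-- The monomial basis of `Sdeg N e`. -/
lemma aux_basis (N : ℕ) (e : ℤ) :
    ∃ b : Basis {σ : Fin N →₀ ℕ // monoC N σ ∈ Sdeg N e} ℂ ↥(Sdeg N e),
      ∀ i, b i = ⟨monoC N i.1, i.2⟩ := by
  have hli : LinearIndependent ℂ
      (fun i : {σ : Fin N →₀ ℕ // monoC N σ ∈ Sdeg N e} => (⟨monoC N i.1, i.2⟩ : ↥(Sdeg N e))) := by
    apply LinearIndependent.of_comp (Sdeg N e).subtype
    have h := (MvPolynomial.basisMonomials (Fin N) ℂ).linearIndependent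
    have h2 := h.comp (fun i : {σ : Fin N →₀ ℕ // monoC N σ ∈ Sdeg N e} => i.1)
      Subtype.val_injective
    have h3 : ((Sdeg N e).subtype ∘
        fun i : {σ : Fin N →₀ ℕ // monoC N σ ∈ Sdeg N e} => (⟨monoC N i.1, i.2⟩ : ↥(Sdeg N e))) =
        (MvPolynomial.basisMonomials (Fin N) ℂ) ∘
          fun i : {σ : Fin N →₀ ℕ // monoC N σ ∈ Sdeg N e} => i.1 := by
      funext i
      rw [MvPolynomial.coe_basisMonomials]
      rfl
    rw [h3]
    exact h2
  have hsp : ⊤ ≤ Submodule.span ℂ (Set.range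
      (fun i : {σ : Fin N →₀ ℕ // monoC N σ ∈ Sdeg N e} =>
        (⟨monoC N i.1, i.2⟩ : ↥(Sdeg N e)))) := by
    rintro ⟨f, hf⟩ -
    have hm : ∀ σ ∈ f.support, monoC N σ ∈ Sdeg N e := by
      intro σ hσ
      by_cases he : 0 ≤ e
      · apply aux_mono_mem N e he
        rw [Sdeg, if_pos he, MvPolynomial.mem_homogeneousSubmodule] at hf
        have h1 := hf (MvPolynomial.mem_support_iff.mp hσ)
        rw [Finsupp.degree_eq_weight_one]
        have : (Finsupp.weight 1) σ = e.toNat := h1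
        change ((Finsupp.weight 1 σ : ℕ) : ℤ) = e
        rw [this]
        omega
      · rw [Sdeg, if_neg he, Submodule.mem_bot] at hf
        simp [hf] at hσ
    have : (⟨f, hf⟩ : ↥(Sdeg N e)) =
        ∑ σ ∈ f.support.attach, (f.coeff σ.1) • (⟨monoC N σ.1, hm σ.1 σ.2⟩ : ↥(Sdeg N e)) := by
      apply Subtype.ext
      rw [Submodule.coe_sum]
      simp only [Submodule.coe_smul]
      rw [Finset.sum_attach f.support (fun σ => f.coeff σ • monoC N σ)]
      conv_lhs => rw [f.as_sum]
      apply Finset.sum_congr rfl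
      intro σ _
      simp [monoC, MvPolynomial.smul_monomial]
    rw [this]
    refine Submodule.sum_mem _ fun σ _ => Submodule.smul_mem _ _ (Submodule.subset_span ?_)
    exact ⟨⟨σ.1, hm σ.1 σ.2⟩, rfl⟩
  exact ⟨Basis.mk hli hsp, fun i => by simp [Basis.mk_apply]⟩

lemma aux_wedge_eq (M : Type*) [AddCommGroup M] [Module ℂ M] (n : ℕ) (m : Fin n → M) :
    wedgeE ℂ M n m = exteriorPower.ιMulti ℂ n m := rfl

/-- A multiplicative weight separating multidegrees. -/
noncomputable def auxW (N : ℕ) (σ : Fin N →₀ ℕ) : ℕ :=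
  σ.prod fun i k => (Nat.nth Nat.Prime (i : ℕ)) ^ k

lemma auxW_add (N : ℕ) (σ τ : Fin N →₀ ℕ) : auxW N (σ + τ) = auxW N σ * auxW N τ := by
  unfold auxW
  exact Finsupp.prod_add_index' (fun _ => pow_zero _) (fun _ _ _ => pow_add _ _ _)

lemma auxW_zero (N : ℕ) : auxW N 0 = 1 := by
  simp [auxW]

lemma auxW_sum (N : ℕ) {ι : Type*} (s : Finset ι) (σ : ι → (Fin N →₀ ℕ)) :
    auxW N (∑ i ∈ s, σ i) = ∏ i ∈ s, auxW N (σ i) := by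
  classical
  induction s using Finset.induction_on with
  | empty => simp [auxW_zero]
  | insert a s ha ih => rw [Finset.sum_insert ha, Finset.prod_insert ha, auxW_add, ih]

lemma auxW_pos (N : ℕ) (σ : Fin N →₀ ℕ) : auxW N σ ≠ 0 := by
  unfold auxW
  rw [Finsupp.prod]
  refine Finset.prod_ne_zero_iff.mpr fun i _ => pow_ne_zero _ ?_
  exact (Nat.prime_nth_prime _).ne_zero

lemma auxW_inj (N : ℕ) : Function.Injective (auxW N) := by
  have hinj : Function.Injective (fun i : Fin N => Nat.nth Nat.Prime (i : ℕ)) :=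
    (Nat.nth_injective Nat.infinite_setOfPred_prime).comp Fin.val_injective
  have key : ∀ σ : Fin N →₀ ℕ,
      (auxW N σ).factorization = σ.embDomain ⟨_, hinj⟩ := by
    intro σ
    rw [← Nat.prod_pow_factorization_eq_self (f := σ.embDomain ⟨_, hinj⟩)]
    · congr 1
      rw [Finsupp.prod_embDomain]
      rfl
    · intro p hp
      rw [Finsupp.support_embDomain, Finset.mem_map] at hp
      obtain ⟨i, _, rfl⟩ := hp
      exact Nat.prime_nth_prime _
  intro σ τ h
  have := key σ
  rw [h, key τ] at this
  exact (Finsupp.embDomain_injective _ this).symm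

lemma aux_phi_tmul (N : ℕ) (d : ℤ) (p : ℕ) (e : ℤ) (ε : ↥(Sdeg N e) →ₗ[ℂ] ℂ)
    (w : ↥(⋀[ℂ]^p ↥(Sdeg N d))) (f : ↥(Sdeg N e)) :
    phiMap N d p e ε (w ⊗ₜ[ℂ] f) = ε f • w := by
  simp [phiMap]

/-- `φ` vanishes at no nonzero element of a multidegree component. -/
lemma aux_inj (N : ℕ) (d e : ℤ) (p : ℕ) (ε : ↥(Sdeg N e) →ₗ[ℂ] ℂ)
    (hε : ∀ (σ : Fin N →₀ ℕ) (h : monoC N σ ∈ Sdeg N e), ε ⟨monoC N σ, h⟩ = 1)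
    (a : Fin N →₀ ℕ) (x : KosModule N d p e) (hx : x ∈ KComp N d p e a)
    (h0 : phiMap N d p e ε x = 0) : x = 0 := by
  classical
  obtain ⟨b, hb⟩ := aux_basis N e
  obtain ⟨c, hc⟩ := aux_basis N d
  let γ : ↥(Sdeg N d) →ₗ[ℂ] ↥(Sdeg N d) := c.constr ℂ fun i => (auxW N i.1 : ℂ) • c i
  have hγ : ∀ (σ : Fin N →₀ ℕ) (h : monoC N σ ∈ Sdeg N d),
      γ ⟨monoC N σ, h⟩ = (auxW N σ : ℂ) • ⟨monoC N σ, h⟩ := by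
    intro σ h
    rw [← hc ⟨σ, h⟩]
    simp only [γ, Basis.constr_basis]
  let g : Module.End ℂ ↥(⋀[ℂ]^p ↥(Sdeg N d)) := exteriorPower.map p γ
  let μ : {σ : Fin N →₀ ℕ // monoC N σ ∈ Sdeg N e} → ℂ :=
    fun τ => (auxW N a : ℂ) / (auxW N τ.1 : ℂ)
  have hμ : Function.Injective μ := by
    intro τ τ' h
    have h1 : (auxW N a : ℂ) ≠ 0 := by exact_mod_cast auxW_pos N a
    have h2 : (auxW N τ.1 : ℂ) ≠ 0 := by exact_mod_cast auxW_pos N τ.1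
    have h3 : (auxW N τ'.1 : ℂ) ≠ 0 := by exact_mod_cast auxW_pos N τ'.1
    simp only [μ] at h
    rw [div_eq_div_iff h2 h3] at h
    have h4 := mul_left_cancel₀ h1 h
    exact Subtype.ext (auxW_inj N (by exact_mod_cast h4.symm))
  let E := TensorProduct.equivFinsuppOfBasisRight (M := ↥(⋀[ℂ]^p ↥(Sdeg N d))) b
  have hE : ∀ τ, E x τ ∈ g.eigenspace (μ τ) := by
    intro τ
    clear h0
    induction hx using Submodule.span_induction with
    | zero => simp
    | add u v _ _ hu hv => rw [map_add]; exact Submodule.add_mem _ hu hv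
    | smul t u _ hu => rw [map_smul]; exact Submodule.smul_mem _ _ hu
    | mem u hu =>
      obtain ⟨σ, ρ, hσ, hρ, hs, rfl⟩ := hu
      rw [TensorProduct.equivFinsuppOfBasisRight_apply_tmul_apply, ← hb ⟨ρ, hρ⟩,
        Basis.repr_self, Finsupp.single_apply]
      split_ifs with hτ
      · rw [one_smul, Module.End.mem_eigenspace_iff, aux_wedge_eq]
        change exteriorPower.map p γ _ = _
        rw [exteriorPower.map_apply_ιMulti]
        have : (γ ∘ fun i => (⟨monoC N (σ i), hσ i⟩ : ↥(Sdeg N d))) =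
            fun i => (auxW N (σ i) : ℂ) • (⟨monoC N (σ i), hσ i⟩ : ↥(Sdeg N d)) := by
          funext i
          exact hγ _ _
        rw [this, AlternatingMap.map_smul_univ]
        congr 1
        subst hτ
        have h2 : (auxW N ρ : ℂ) ≠ 0 := by exact_mod_cast auxW_pos N ρ
        simp only [μ]
        rw [eq_div_iff h2, ← hs, auxW_add, auxW_sum]
        push_cast
        rfl
      · rw [zero_smul]
        exact Submodule.zero_mem _
  have hφ : ∀ y, phiMap N d p e ε y = (E y).sum fun _ w => w := by
    intro y
    have : phiMap N d p e ε = (Finsupp.lsum ℂ fun _ => LinearMap.id) ∘ₗ E.toLinearMap := by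
      apply TensorProduct.ext'
      intro w f
      rw [aux_phi_tmul]
      have : (LinearMap.toSpanSingleton ℂ _ w) ∘ₗ ε =
          ((Finsupp.lsum ℂ fun _ => LinearMap.id) ∘ₗ E.toLinearMap) ∘ₗ
            (TensorProduct.mk ℂ _ _ w) := by
        apply b.ext
        intro i
        have h1 : ε (b i) = 1 := by rw [hb]; exact hε _ _
        have h2 : E (w ⊗ₜ[ℂ] b i) = Finsupp.single i w := by
          ext1 j
          rw [TensorProduct.equivFinsuppOfBasisRight_apply_tmul_apply, Basis.repr_self,
            Finsupp.single_apply, Finsupp.single_apply]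
          split_ifs <;> simp
        simp [h1, h2]
      exact LinearMap.congr_fun this f
    rw [this]
    rfl
  have hind : iSupIndep fun τ => g.eigenspace (μ τ) :=
    (Module.End.eigenspaces_iSupIndep g).comp hμ
  rw [iSupIndep_iff_finsetSum_eq_zero_imp_eq_zero] at hind
  rw [hφ, Finsupp.sum] at h0
  have hz := hind (E x).support (fun τ => E x τ) (fun τ _ => hE τ) h0
  apply E.injective
  rw [map_zero]
  ext1 τ
  by_cases hτ : τ ∈ (E x).support
  · exact hz τ hτ
  · simpa using hτ

lemma aux_injOn (N : ℕ) (d e : ℤ) (p : ℕ) (ε : ↥(Sdeg N e) →ₗ[ℂ] ℂ)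
    (hε : ∀ (σ : Fin N →₀ ℕ) (h : monoC N σ ∈ Sdeg N e), ε ⟨monoC N σ, h⟩ = 1)
    (a : Fin N →₀ ℕ) (x y : KosModule N d p e) (hx : x ∈ KComp N d p e a)
    (hy : y ∈ KComp N d p e a)
    (h0 : phiMap N d p e ε x = phiMap N d p e ε y) : x = y := by
  have h1 : x + (-1 : ℂ) • y = 0 := by
    apply aux_inj N d e p ε hε a _ (Submodule.add_mem _ hx (Submodule.smul_mem _ _ hy))
    rw [map_add, map_smul, h0]
    generalize phiMap N d p e ε y = z
    exact (congrArg (z + ·) (neg_one_smul ℂ z)).trans (add_neg_cancel z)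
  calc x = (x + (-1 : ℂ) • y) + y := by
        rw [add_assoc, ← one_smul ℂ y, smul_smul, ← add_smul]
        simp
    _ = y := by rw [h1, zero_add]

/-- The Koszul differential on monomial pure tensors. -/
lemma aux_D (N : ℕ) (d e : ℤ) (q : ℕ)
    (D : KosModule N d (q + 1) e →ₗ[ℂ] KosModule N d q (e + d))
    (hD : IsKoszulDiff N d e (e + d) q D) (m : Fin (q + 1) → ↥(Sdeg N d)) (f : ↥(Sdeg N e)) :
    D (wedgeE ℂ ↥(Sdeg N d) (q + 1) m ⊗ₜ[ℂ] f) =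
      ∑ k : Fin (q + 1), ((-1 : ℂ) ^ ((k : ℕ) + 1)) •
        (wedgeE ℂ ↥(Sdeg N d) q (fun i => m (Fin.succAbove k i)) ⊗ₜ[ℂ]
          (⟨(m k : PolyC N) * (f : PolyC N), aux_mul_mem N d e (m k).2 f.2⟩ :
            ↥(Sdeg N (e + d)))) := by
  have hinj : Function.Injective
      (TensorProduct.map (LinearMap.id (R := ℂ) (M := ↥(⋀[ℂ]^q ↥(Sdeg N d))))
        (Sdeg N (e + d)).subtype) :=
    Module.Flat.lTensor_preserves_injective_linearMap (M := ↥(⋀[ℂ]^q ↥(Sdeg N d)))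
      (Sdeg N (e + d)).subtype (Submodule.subtype_injective _)
  apply hinj
  rw [hD m f, map_sum]
  apply Finset.sum_congr rfl
  intro k _
  rw [map_smul, TensorProduct.map_tmul]
  rfl

lemma aux_D_comp (N : ℕ) (d e : ℤ) (q : ℕ)
    (D : KosModule N d (q + 1) e →ₗ[ℂ] KosModule N d q (e + d))
    (hD : IsKoszulDiff N d e (e + d) q D) (a : Fin N →₀ ℕ) :
    Submodule.map D (KComp N d (q + 1) e a) ≤ KComp N d q (e + d) a := by
  rw [KComp, Submodule.map_span_le]
  rintro x ⟨σ, τ, hσ, hτ, hs, rfl⟩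
  rw [aux_D N d e q D hD]
  refine Submodule.sum_mem _ fun k _ => Submodule.smul_mem _ _ (Submodule.subset_span ?_)
  have hmem : monoC N (σ k + τ) ∈ Sdeg N (e + d) := by
    rw [← aux_mono_mul]
    exact aux_mul_mem N d e (hσ k) hτ
  refine ⟨fun i => σ (k.succAbove i), σ k + τ, fun i => hσ _, hmem, ?_, ?_⟩
  · rw [← hs, Fin.sum_univ_succAbove σ k]
    abel
  · congr 1
    apply Subtype.ext
    exact aux_mono_mul N (σ k) τ

end KoszulSlicingAux

/-- Matrix-slicing identity: with `ε` the functionals taking the value 1 on every monomial,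
`φ = id ⊗ ε`, and `δ_p` the contraction of `⋀^p S_d` with `ε_d`, we have
`δ_p ∘ φ_p = φ_{p-1} ∘ ∂_p`, and `φ_p` is injective on each multidegree component
(so the restricted differential `∂_{p,a}` is represented by a submatrix of `δ_p`). -/
theorem koszul_matrix_slicing
    (d : ℤ) (hd : 1 ≤ d) (e : ℤ) (he : 0 ≤ e) (p : ℕ) (hp : 1 ≤ p)
    (εe : ↥(Sdeg 3 e) →ₗ[ℂ] ℂ)
    (hεe : ∀ (σ : Fin 3 →₀ ℕ) (h : monoC 3 σ ∈ Sdeg 3 e), εe ⟨monoC 3 σ, h⟩ = 1)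
    (εed : ↥(Sdeg 3 (e + d)) →ₗ[ℂ] ℂ)
    (hεed : ∀ (σ : Fin 3 →₀ ℕ) (h : monoC 3 σ ∈ Sdeg 3 (e + d)), εed ⟨monoC 3 σ, h⟩ = 1)
    (δ : ↥(⋀[ℂ]^(p - 1 + 1) ↥(Sdeg 3 d)) →ₗ[ℂ] ↥(⋀[ℂ]^(p - 1) ↥(Sdeg 3 d)))
    (hδ : ∀ m : Fin (p - 1 + 1) → ↥(Sdeg 3 d), (∀ i, ∃ σ, ((m i : PolyC 3) = monoC 3 σ)) →
      δ (wedgeE ℂ ↥(Sdeg 3 d) (p - 1 + 1) m) =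
        ∑ k : Fin (p - 1 + 1), ((-1 : ℂ) ^ ((k : ℕ) + 1)) •
          wedgeE ℂ ↥(Sdeg 3 d) (p - 1) (fun i => m (Fin.succAbove k i)))
    (Dp : KosModule 3 d (p - 1 + 1) e →ₗ[ℂ] KosModule 3 d (p - 1) (e + d))
    (hDp : IsKoszulDiff 3 d e (e + d) (p - 1) Dp) :
    (δ ∘ₗ phiMap 3 d (p - 1 + 1) e εe = phiMap 3 d (p - 1) (e + d) εed ∘ₗ Dp) ∧
    ∀ a : Fin 3 →₀ ℕ, ((a.sum fun _ m => (m : ℤ)) = (p : ℤ) * d + e) →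
      Function.Injective
        (phiMap 3 d (p - 1 + 1) e εe ∘ₗ (KComp 3 d (p - 1 + 1) e a).subtype) ∧
      cdim ↥(Submodule.map Dp (KComp 3 d (p - 1 + 1) e a)) =
        cdim ↥(Submodule.map δ
          (Submodule.map (phiMap 3 d (p - 1 + 1) e εe) (KComp 3 d (p - 1 + 1) e a))) := by
  have hcomm : δ ∘ₗ phiMap 3 d (p - 1 + 1) e εe = phiMap 3 d (p - 1) (e + d) εed ∘ₗ Dp := by
    obtain ⟨b, hb⟩ := aux_basis 3 e
    obtain ⟨c, hc⟩ := aux_basis 3 d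
    apply TensorProduct.ext'
    intro w f
    suffices hs : ∀ j,
        (δ ∘ₗ phiMap 3 d (p - 1 + 1) e εe) ∘ₗ (TensorProduct.mk ℂ _ _).flip (b j) =
          (phiMap 3 d (p - 1) (e + d) εed ∘ₗ Dp) ∘ₗ (TensorProduct.mk ℂ _ _).flip (b j) by
      have hw : (δ ∘ₗ phiMap 3 d (p - 1 + 1) e εe) ∘ₗ (TensorProduct.mk ℂ _ _) w =
          (phiMap 3 d (p - 1) (e + d) εed ∘ₗ Dp) ∘ₗ (TensorProduct.mk ℂ _ _) w :=
        b.ext fun j => LinearMap.congr_fun (hs j) w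
      exact LinearMap.congr_fun hw f
    intro j
    apply exteriorPower.linearMap_ext
    apply Module.Basis.ext_alternating c
    intro v _
    have hm : ∀ i, ∃ σ, ((c (v i) : PolyC 3) = monoC 3 σ) := fun i => ⟨(v i).1, by rw [hc]⟩
    change δ (phiMap 3 d (p - 1 + 1) e εe
        (wedgeE ℂ ↥(Sdeg 3 d) (p - 1 + 1) (fun i => c (v i)) ⊗ₜ[ℂ] b j)) =
      phiMap 3 d (p - 1) (e + d) εed
        (Dp (wedgeE ℂ ↥(Sdeg 3 d) (p - 1 + 1) (fun i => c (v i)) ⊗ₜ[ℂ] b j))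
    have h1 : εe (b j) = 1 := by rw [hb]; exact hεe _ _
    rw [aux_phi_tmul, h1, one_smul, hδ _ hm, aux_D 3 d e (p - 1) Dp hDp, map_sum]
    apply Finset.sum_congr rfl
    intro k _
    rw [map_smul, aux_phi_tmul]
    have h2 : ∀ (f : ↥(Sdeg 3 (e + d))), (f : PolyC 3) = monoC 3 ((v k).1 + j.1) →
        εed f = 1 := by
      rintro ⟨f, hf⟩ h
      simp only at h
      subst h
      exact hεed _ _
    rw [h2, one_smul]
    rw [← aux_mono_mul, hc, hb]
  refine ⟨hcomm, fun a _ => ⟨?_, ?_⟩⟩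
  · rintro ⟨x, hx⟩ ⟨y, hy⟩ h
    apply Subtype.ext
    exact aux_injOn 3 d e (p - 1 + 1) εe hεe a x y hx hy h
  · have hle := aux_D_comp 3 d e (p - 1) Dp hDp a
    rw [← Submodule.map_comp, hcomm, Submodule.map_comp]
    generalize hL : Submodule.map Dp (KComp 3 d (p - 1 + 1) e a) = L at hle ⊢
    have hinj : Function.Injective ((phiMap 3 d (p - 1) (e + d) εed).domRestrict L) := by
      rintro ⟨x, hx⟩ ⟨y, hy⟩ h
      apply Subtype.ext
      exact aux_injOn 3 d (e + d) (p - 1) εed hεed a x y (hle hx) (hle hy) h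
    have heq := (LinearEquiv.ofInjective _ hinj).rank_eq
    rw [LinearMap.range_domRestrict] at heq
    unfold cdim
    rw [heq]
end

section
/- (Duality instances for Veronese syzygies of ℙ²) For d = 5 and all integers p ≥ 0 and q: dim K_{p,q}(ℙ²,2;5) = dim K_{18−p, 2−q}(ℙ²,0;5), where 18 = C(7,2) − 3; and for d = 4 and all integers p ≥ 0 and q: dim K_{p,q}(ℙ²,1;4) = dim K_{12−p, 2−q}(ℙ²,0;4), where 12 = C(6,2) − 3. (Here dim K_{p,q} is interpreted as 0 when the index 18−p, respectively 12−p, is negative.) -/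
open scoped TensorProduct

set_option maxHeartbeats 2000000
set_option synthInstance.maxHeartbeats 1000000

open scoped TensorProduct

set_option maxHeartbeats 2000000
set_option synthInstance.maxHeartbeats 1000000

set_option linter.unusedSectionVars false

noncomputable section VD

namespace VD

open Finset Module

/-- exponents -/
abbrev U : Type := Fin 3 →₀ ℕ

/-- total space of the coordinate model of the Koszul complex -/
abbrev XX (ι : Type) : Type := Finset ι × U → ℂ

structure KS (ι : Type) where
  d : ℕ
  hd : 0 < d
  σ : ι → U
  o : Fin 3 → ι
  o_inj : Function.Injective o
  hσ : ∀ i, (σ i).degree = d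
  ho : ∀ k, σ (o k) = Finsupp.single k d

variable {ι : Type} [LinearOrder ι] [Fintype ι]

def sg (i : ι) (s : Finset ι) : ℂ := (-1) ^ (s.filter (· < i)).card

lemma sg_sq (i : ι) (s : Finset ι) : sg i s * sg i s = 1 := by
  unfold sg; rw [← mul_pow]; simp

lemma sg_ne (i : ι) (s : Finset ι) : sg i s ≠ 0 := by
  intro h; have := sg_sq i s; rw [h] at this; simp at this

lemma sg_insert_lt {i j : ι} {s : Finset ι} (hj : j ∉ s) (h : j < i) :
    sg i (insert j s) = - sg i s := by
  unfold sg
  rw [Finset.filter_insert, if_pos h, Finset.card_insert_of_notMem (by simp [hj]), pow_succ]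
  ring

lemma sg_insert_gt {i j : ι} {s : Finset ι} (h : ¬ j < i) :
    sg i (insert j s) = sg i s := by
  unfold sg
  rw [Finset.filter_insert, if_neg h]

lemma sg_anti {i j : ι} {s : Finset ι} (hi : i ∉ s) (hj : j ∉ s) (hij : i ≠ j) :
    sg i s * sg j (insert i s) = - (sg j s * sg i (insert j s)) := by
  rcases lt_or_gt_of_ne hij with h | h
  · rw [sg_insert_lt hi h, sg_insert_gt (not_lt.2 h.le)]; ring
  · rw [sg_insert_lt hj h, sg_insert_gt (not_lt.2 h.le)]; ring

variable (κ : KS ι)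

def BB (P : Finset (Fin 3)) (u : U) : Prop := ∀ k ∈ P, u k < κ.d

open Classical in
/-- Koszul differential in coordinates -/
def dd (P : Finset (Fin 3)) : XX ι →ₗ[ℂ] XX ι where
  toFun f a := if BB κ P a.2 then
    ∑ i ∈ a.1ᶜ, (if κ.σ i ≤ a.2 then sg i a.1 * f (insert i a.1, a.2 - κ.σ i) else 0) else 0
  map_add' f g := by
    funext a
    simp only [Pi.add_apply]
    split_ifs
    · rw [← Finset.sum_add_distrib]
      refine Finset.sum_congr rfl fun i _ => ?_
      split_ifs <;> ring
    · simp
  map_smul' c f := by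
    funext a
    simp only [Pi.smul_apply, smul_eq_mul, RingHom.id_apply]
    split_ifs
    · rw [Finset.mul_sum]
      refine Finset.sum_congr rfl fun i _ => ?_
      split_ifs <;> ring
    · simp

open Classical in
lemma dd_apply (P : Finset (Fin 3)) (f : XX ι) (s : Finset ι) (v : U) :
    dd κ P f (s, v) = if BB κ P v then
    ∑ i ∈ sᶜ, (if κ.σ i ≤ v then sg i s * f (insert i s, v - κ.σ i) else 0) else 0 := rfl

lemma BB_sub {P : Finset (Fin 3)} {v : U} (h : BB κ P v) (w : U) : BB κ P (v - w) := by
  intro k hk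
  have := h k hk
  simp only [Finsupp.tsub_apply]; omega

lemma dd_sq (P : Finset (Fin 3)) (f : XX ι) : dd κ P (dd κ P f) = 0 := by
  classical
  funext ⟨s, v⟩
  rw [dd_apply]
  split_ifs with hv
  swap
  · rfl
  let G : ι → ι → ℂ := fun i j => if i ∈ s ∨ j ∈ s ∨ i = j ∨ ¬ (κ.σ i + κ.σ j ≤ v) then 0 else
    sg i s * sg j (insert i s) * f (insert j (insert i s), v - (κ.σ i + κ.σ j))
  have hG : ∀ i j, G i j = - G j i := by
    intro i j
    simp only [G]
    by_cases h : i ∈ s ∨ j ∈ s ∨ i = j ∨ ¬ (κ.σ i + κ.σ j ≤ v)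
    · rw [if_pos h, if_pos, neg_zero]
      rw [add_comm (κ.σ j)]
      tauto
    · rw [if_neg h, if_neg]
      · push Not at h
        rw [sg_anti h.1 h.2.1 h.2.2.1, Finset.insert_comm, add_comm (κ.σ j)]
        ring
      · rw [add_comm (κ.σ j)]
        tauto
  have key : ∑ i, ∑ j, G i j = 0 := by
    have h1 : ∑ i, ∑ j, G i j = - ∑ i, ∑ j, G i j := by
      conv_lhs => rw [Finset.sum_comm]
      rw [← Finset.sum_neg_distrib]
      refine Finset.sum_congr rfl fun i _ => ?_
      rw [← Finset.sum_neg_distrib]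
      exact Finset.sum_congr rfl fun j _ => hG j i
    have h2 : (2 : ℂ) * ∑ i, ∑ j, G i j = 0 := by linear_combination h1
    simpa using h2
  change _ = (0 : ℂ)
  refine Eq.trans ?_ key
  rw [← Finset.sum_subset (Finset.subset_univ (sᶜ))]
  · refine Finset.sum_congr rfl fun i hi => ?_
    rw [Finset.mem_compl] at hi
    rw [← Finset.sum_subset (Finset.subset_univ ((insert i s)ᶜ))]
    · split_ifs with h1
      · rw [dd_apply, if_pos (BB_sub κ hv _), Finset.mul_sum]
        refine Finset.sum_congr rfl fun j hj => ?_
        simp only [Finset.mem_compl, Finset.mem_insert, not_or] at hj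
        have e : κ.σ j ≤ v - κ.σ i ↔ κ.σ i + κ.σ j ≤ v := by
          rw [le_tsub_iff_left h1]
        simp only [G, hi, hj.2, Ne.symm hj.1, false_or, e]
        by_cases h3 : κ.σ i + κ.σ j ≤ v
        · simp only [h3, if_true, not_true, if_false, tsub_tsub]; ring
        · simp [h3]
      · refine Eq.symm (Finset.sum_eq_zero (f := G i) fun j hj => ?_)
        simp only [G]
        rw [if_pos]
        right; right; right
        intro h; exact h1 (le_trans (by simp) h)
    · intro j _ hj
      simp only [Finset.mem_compl, Finset.mem_insert, not_not] at hj
      simp only [G]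
      rw [if_pos]
      rcases hj with h | h
      · right; right; left; exact h.symm
      · tauto
  · intro i _ hi
    simp only [Finset.mem_compl, not_not] at hi
    refine Finset.sum_eq_zero fun j _ => ?_
    simp only [G]
    rw [if_pos (Or.inl hi)]

/-- functions supported on a set -/
def supp {J : Type} (I : Set J) : Submodule ℂ (J → ℂ) where
  carrier := {f | ∀ a, a ∉ I → f a = 0}
  add_mem' := by intro f g hf hg a ha; simp [hf a ha, hg a ha]
  zero_mem' := by intro a _; rfl
  smul_mem' := by intro c f hf a ha; simp [hf a ha]

lemma mem_supp {J : Type} {I : Set J} {f : J → ℂ} : f ∈ supp I ↔ ∀ a, a ∉ I → f a = 0 := Iff.rfl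

open Classical in
def suppEquiv {J : Type} (I : Set J) : supp I ≃ₗ[ℂ] (I → ℂ) where
  toFun f a := f.1 a.1
  map_add' f g := rfl
  map_smul' c f := rfl
  invFun g := ⟨fun a => if h : a ∈ I then g ⟨a, h⟩ else 0, by intro a ha; simp [ha]⟩
  left_inv f := by
    ext a
    by_cases h : a ∈ I
    · simp [h]
    · simp [h, f.2 a h]
  right_inv g := by
    ext a
    simp

/-- indices of the degree `(p,t)` part -/
def II (P : Finset (Fin 3)) (p t : ℤ) : Set (Finset ι × U) :=
  {a | (∀ k ∈ P, κ.o k ∉ a.1) ∧ BB κ P a.2 ∧ (a.1.card : ℤ) = p ∧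
    (a.2.degree : ℤ) + p * κ.d = t}

lemma II_finite (P : Finset (Fin 3)) (p t : ℤ) : (II κ P p t).Finite := by
  refine Set.Finite.subset (s := (Set.univ : Set (Finset ι)) ×ˢ
    {u : U | u.degree = (t - p * κ.d).toNat}) ?_ ?_
  · refine Set.Finite.prod Set.finite_univ ?_
    refine Set.Finite.subset (Finset.finsuppAntidiag (Finset.univ : Finset (Fin 3))
      (t - p * κ.d).toNat).finite_toSet ?_
    intro u hu
    simp only [Set.mem_ofPred_eq] at hu
    simp [Finset.mem_finsuppAntidiag, ← hu, Finsupp.degree_eq_sum]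
  · rintro ⟨s, u⟩ ⟨_, _, h1, h2⟩
    simp only [Set.mem_prod, Set.mem_univ, true_and, Set.mem_ofPred_eq]
    simp only at h2
    omega

instance (P : Finset (Fin 3)) (p t : ℤ) : Finite (II κ P p t) := II_finite κ P p t

abbrev XP (P : Finset (Fin 3)) (p t : ℤ) : Submodule ℂ (XX ι) := supp (II κ P p t)

instance fin_supp {J : Type} (I : Set J) [Finite I] : FiniteDimensional ℂ (supp I) :=
  LinearEquiv.finiteDimensional (suppEquiv I).symm

lemma mem_II {P : Finset (Fin 3)} {p t : ℤ} {s : Finset ι} {v : U} : (s, v) ∈ II κ P p t ↔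
  (∀ k ∈ P, κ.o k ∉ s) ∧ BB κ P v ∧ (s.card : ℤ) = p ∧ (v.degree : ℤ) + p * κ.d = t := Iff.rfl

lemma ne_mem {J : Type} {I : Set J} {f : J → ℂ} (hf : f ∈ supp I) {a : J} (h : f a ≠ 0) : a ∈ I := by
  by_contra h'; exact h (hf a h')

lemma of_ne {J : Type} {I : Set J} {f : J → ℂ} (h : ∀ a, f a ≠ 0 → a ∈ I) : f ∈ supp I := by
  intro a ha; by_contra h'; exact ha (h a h')

lemma dd_mem {P : Finset (Fin 3)} {p t : ℤ} {f : XX ι} (hf : f ∈ XP κ P p t) :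
    dd κ P f ∈ XP κ P (p - 1) t := by
  classical
  apply of_ne
  rintro ⟨s, v⟩ h
  rw [dd_apply] at h
  split_ifs at h with hv
  swap
  · exact absurd rfl h
  obtain ⟨i, hi, hne⟩ := Finset.exists_ne_zero_of_sum_ne_zero h
  rw [Finset.mem_compl] at hi
  split_ifs at hne with hle
  swap
  · exact absurd rfl hne
  have := ne_mem hf (right_ne_zero_of_mul hne)
  rw [mem_II] at this ⊢
  obtain ⟨h1, h2, h3, h4⟩ := this
  refine ⟨fun k hk hk' => h1 k hk (Finset.mem_insert_of_mem hk'), hv, ?_, ?_⟩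
  · rw [Finset.card_insert_of_notMem hi] at h3; push_cast at h3; omega
  · have e : v.degree = (v - κ.σ i).degree + κ.d := by
      rw [← κ.hσ i, ← map_add, tsub_add_cancel_of_le hle]
    rw [e]; push_cast; linear_combination h4

/-- dimension of the homology of the model -/
def hh (P : Finset (Fin 3)) (p t : ℤ) : ℕ :=
  finrank ℂ ↥(LinearMap.ker (dd κ P) ⊓ XP κ P p t) -
    finrank ℂ ↥((XP κ P (p + 1) t).map (dd κ P))

lemma finrank_map_inf {V W : Type} [AddCommGroup V] [Module ℂ V] [AddCommGroup W] [Module ℂ W]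
    (f : V →ₗ[ℂ] W) (Z : Submodule ℂ V) [FiniteDimensional ℂ Z] :
    finrank ℂ ↥(Z.map f) + finrank ℂ ↥(LinearMap.ker f ⊓ Z) = finrank ℂ Z := by
  rw [← LinearMap.finrank_range_add_finrank_ker (f.domRestrict Z)]
  congr 1
  · rw [LinearMap.range_domRestrict]
  · rw [LinearMap.ker_domRestrict]
    have : (LinearMap.ker f ⊓ Z) = (Submodule.comap Z.subtype (LinearMap.ker f)).map Z.subtype := by
      rw [Submodule.map_comap_subtype, inf_comm]
    rw [this]
    exact (Submodule.equivMapOfInjective _ Z.injective_subtype _).symm.finrank_eq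

/-- restriction to `P ∪ {k}` -/
def rr (k : Fin 3) : XX ι →ₗ[ℂ] XX ι where
  toFun f a := if κ.o k ∈ a.1 ∨ κ.d ≤ a.2 k then 0 else f a
  map_add' f g := by funext a; simp only [Pi.add_apply]; split_ifs <;> simp
  map_smul' c f := by funext a; simp only [Pi.smul_apply, RingHom.id_apply]; split_ifs <;> simp

lemma rr_apply (k : Fin 3) (f : XX ι) (s : Finset ι) (v : U) :
    rr κ k f (s, v) = if κ.o k ∈ s ∨ κ.d ≤ v k then 0 else f (s, v) := rfl

lemma BB_insert {P : Finset (Fin 3)} {k : Fin 3} {v : U} :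
    BB κ (insert k P) v ↔ v k < κ.d ∧ BB κ P v := by simp [BB]

lemma rr_comm (P : Finset (Fin 3)) (k : Fin 3) (f : XX ι) :
    dd κ (insert k P) (rr κ k f) = rr κ k (dd κ P f) := by
  classical
  funext ⟨s, v⟩
  rw [rr_apply, dd_apply, dd_apply, BB_insert]
  by_cases h1 : κ.d ≤ v k
  · simp [h1, not_lt.2 h1]
  by_cases hv : BB κ P v
  swap
  · simp [hv]
  rw [not_le] at h1
  simp only [h1, hv, and_self, if_true, not_le.2 h1, or_false]
  by_cases h2 : κ.o k ∈ s
  · rw [if_pos h2]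
    refine Finset.sum_eq_zero fun i hi => ?_
    rw [rr_apply, if_pos (Or.inl (Finset.mem_insert_of_mem h2))]
    simp
  · rw [if_neg h2]
    refine Finset.sum_congr rfl fun i hi => ?_
    split_ifs with hle
    swap
    · rfl
    have : i ≠ κ.o k := by
      rintro rfl
      have := hle k
      rw [κ.ho] at this
      simp at this; omega
    rw [rr_apply, if_neg]
    rw [Finset.mem_insert, not_or, not_or]
    refine ⟨⟨this.symm, h2⟩, ?_⟩
    rw [Finsupp.tsub_apply]; omega

lemma rr_mem {P : Finset (Fin 3)} {k : Fin 3} {p t : ℤ} {f : XX ι} (hf : f ∈ XP κ P p t) :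
    rr κ k f ∈ XP κ (insert k P) p t := by
  apply of_ne
  rintro ⟨s, v⟩ h
  rw [rr_apply] at h
  split_ifs at h with h1
  · exact absurd rfl h
  rw [not_or, not_le] at h1
  obtain ⟨a, b, c, e⟩ := (mem_II κ).1 (ne_mem hf h)
  refine (mem_II κ).2 ⟨?_, (BB_insert κ).2 ⟨h1.2, b⟩, c, e⟩
  intro j hj
  rcases Finset.mem_insert.1 hj with rfl | hj
  · exact h1.1
  · exact a j hj

lemma XP_insert_le (P : Finset (Fin 3)) (k : Fin 3) (p t : ℤ) :
    XP κ (insert k P) p t ≤ XP κ P p t := by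
  intro f hf
  apply of_ne
  rintro ⟨s, v⟩ h
  obtain ⟨a, b, c, e⟩ := (mem_II κ).1 (ne_mem hf h)
  exact (mem_II κ).2 ⟨fun j hj => a j (Finset.mem_insert_of_mem hj), ((BB_insert κ).1 b).2, c, e⟩

lemma rr_self {P : Finset (Fin 3)} {k : Fin 3} {p t : ℤ} {f : XX ι}
    (hf : f ∈ XP κ (insert k P) p t) : rr κ k f = f := by
  funext ⟨s, v⟩
  rw [rr_apply]
  split_ifs with h
  · by_contra h'
    obtain ⟨a, b, c, e⟩ := (mem_II κ).1 (ne_mem hf (Ne.symm h'))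
    rcases h with h | h
    · exact a k (Finset.mem_insert_self _ _) h
    · have := ((BB_insert κ).1 b).1
      omega
  · rfl

lemma acyc {P : Finset (Fin 3)} {k : Fin 3} (hk : k ∉ P) {p t : ℤ} {x : XX ι}
    (hx : x ∈ XP κ P p t) (hr : rr κ k x = 0) (hd : dd κ P x = 0) :
    ∃ y ∈ XP κ P (p + 1) t, rr κ k y = 0 ∧ dd κ P y = x := by
  classical
  let δ : U := Finsupp.single k κ.d
  let y : XX ι := fun a => if κ.o k ∈ a.1 then
    sg (κ.o k) (a.1.erase (κ.o k)) * x (a.1.erase (κ.o k), a.2 + δ) else 0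
  have hBδ : ∀ v, BB κ P (v + δ) ↔ BB κ P v := by
    intro v
    refine forall₂_congr fun j hj => ?_
    have : k ≠ j := by rintro rfl; exact hk hj
    simp [δ, this]
  have hy : y ∈ XP κ P (p + 1) t := by
    apply of_ne
    rintro ⟨s, v⟩ h
    simp only [y] at h
    split_ifs at h with h1
    swap
    · exact absurd rfl h
    obtain ⟨a, b, c, e⟩ := (mem_II κ).1 (ne_mem hx (right_ne_zero_of_mul h))
    refine (mem_II κ).2 ⟨?_, (hBδ v).1 b, ?_, ?_⟩
    · intro j hj hjs
      refine a j hj (Finset.mem_erase.2 ⟨?_, hjs⟩)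
      intro h; rw [κ.o_inj h] at hj; exact hk hj
    · have := Finset.card_erase_add_one h1; omega
    · simp only [map_add, δ, Finsupp.degree_single] at e
      push_cast at e
      linear_combination e
  refine ⟨y, hy, ?_, ?_⟩
  · funext ⟨s, v⟩
    rw [rr_apply]
    split_ifs with h
    · rfl
    · rw [not_or] at h
      simp only [y, if_neg h.1]; rfl
  have hy0 : ∀ s v, κ.o k ∉ s → dd κ P y (s, v) = x (s, v) := by
    intro s v hs
    rw [dd_apply]
    split_ifs with hv
    swap
    · by_contra h
      exact hv ((mem_II κ).1 (ne_mem hx (Ne.symm h))).2.1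
    rw [Finset.sum_eq_single (κ.o k)]
    · rw [κ.ho]
      split_ifs with hle
      · simp only [y, Finset.mem_insert_self, if_true, Finset.erase_insert hs, δ,
          tsub_add_cancel_of_le hle]
        rw [← mul_assoc, sg_sq, one_mul]
      · have h0 := congrFun hr (s, v)
        rw [rr_apply, if_neg] at h0
        · exact h0.symm
        · rw [not_or]
          refine ⟨hs, fun h => hle ?_⟩
          simpa using h
    · intro i hi hne
      have : y (insert i s, v - κ.σ i) = 0 := by
        simp only [y]
        rw [if_neg]
        rw [Finset.mem_insert, not_or]
        exact ⟨hne.symm, hs⟩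
      simp [this]
    · intro h
      exact absurd (Finset.mem_compl.2 hs) h
  set z := x - dd κ P y with hz
  have hdz : dd κ P z = 0 := by rw [hz, map_sub, dd_sq, hd, sub_zero]
  have hz0 : ∀ s v, κ.o k ∉ s → z (s, v) = 0 := by
    intro s v hs
    simp [hz, hy0 s v hs]
  have : z = 0 := by
    funext ⟨s, v⟩
    by_cases hs : κ.o k ∈ s
    swap
    · exact hz0 s v hs
    by_cases hv : BB κ P v
    · have h1 := congrFun hdz (s.erase (κ.o k), v + δ)
      rw [dd_apply, if_pos ((hBδ v).2 hv), Finset.sum_eq_single (κ.o k)] at h1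
      · rw [κ.ho, if_pos (by simp [δ]), Finset.insert_erase hs] at h1
        simp only [δ, add_tsub_cancel_right] at h1
        exact (mul_eq_zero.1 h1).resolve_left (sg_ne _ _)
      · intro i hi hne
        rw [hz0]
        · simp
        · rw [Finset.mem_insert, not_or]
          exact ⟨hne.symm, Finset.notMem_erase _ _⟩
      · intro h
        exact absurd (Finset.mem_compl.2 (Finset.notMem_erase _ _)) h
    · have hx0 : x (s, v) = 0 := by
        by_contra h
        exact hv ((mem_II κ).1 (ne_mem hx h)).2.1
      simp only [hz, Pi.sub_apply, hx0, dd_apply, if_neg hv]; simp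
  exact (sub_eq_zero.1 this).symm

lemma dd_map_le {P : Finset (Fin 3)} {p t : ℤ} :
    (XP κ P (p + 1) t).map (dd κ P) ≤ LinearMap.ker (dd κ P) ⊓ XP κ P p t := by
  rintro _ ⟨y, hy, rfl⟩
  refine ⟨dd_sq κ P y, ?_⟩
  have := dd_mem κ hy
  rwa [add_sub_cancel_right] at this

lemma hh_step {P : Finset (Fin 3)} {k : Fin 3} (hk : k ∉ P) (p t : ℤ) :
    hh κ P p t = hh κ (insert k P) p t := by
  have hZ : (LinearMap.ker (dd κ P) ⊓ XP κ P p t).map (rr κ k) =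
      LinearMap.ker (dd κ (insert k P)) ⊓ XP κ (insert k P) p t := by
    apply le_antisymm
    · rintro _ ⟨x, ⟨hx1, hx2⟩, rfl⟩
      refine ⟨?_, rr_mem κ hx2⟩
      have hx1 : dd κ P x = 0 := hx1
      change dd κ (insert k P) (rr κ k x) = 0
      rw [rr_comm, hx1, map_zero]
    · rintro y ⟨hy1, hy2⟩
      have hy1 : dd κ (insert k P) y = 0 := hy1
      have hyX := XP_insert_le κ P k p t hy2
      have h1 : rr κ k (dd κ P y) = 0 := by rw [← rr_comm, rr_self κ hy2, hy1]
      obtain ⟨z, hz, hz1, hz2⟩ := acyc κ hk (dd_mem κ hyX) h1 (dd_sq κ P y)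
      rw [sub_add_cancel] at hz
      refine ⟨y - z, ⟨?_, Submodule.sub_mem _ hyX hz⟩, ?_⟩
      · change dd κ P (y - z) = 0
        rw [map_sub, hz2, sub_self]
      · rw [map_sub, hz1, sub_zero, rr_self κ hy2]
  have hB : ((XP κ P (p + 1) t).map (dd κ P)).map (rr κ k) =
      (XP κ (insert k P) (p + 1) t).map (dd κ (insert k P)) := by
    apply le_antisymm
    · rintro _ ⟨_, ⟨x, hx, rfl⟩, rfl⟩
      exact ⟨rr κ k x, rr_mem κ hx, rr_comm κ P k x⟩
    · rintro _ ⟨y, hy, rfl⟩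
      refine ⟨_, ⟨y, XP_insert_le κ P k _ t hy, rfl⟩, ?_⟩
      rw [← rr_comm, rr_self κ hy]
  have hK : LinearMap.ker (rr κ k) ⊓ (LinearMap.ker (dd κ P) ⊓ XP κ P p t) =
      LinearMap.ker (rr κ k) ⊓ ((XP κ P (p + 1) t).map (dd κ P)) := by
    apply le_antisymm
    · rintro x ⟨h1, h2, h3⟩
      obtain ⟨y, hy, _, hy2⟩ := acyc κ hk h3 h1 h2
      exact ⟨h1, ⟨y, hy, hy2⟩⟩
    · exact inf_le_inf le_rfl (dd_map_le κ)
  have e1 := finrank_map_inf (rr κ k) (LinearMap.ker (dd κ P) ⊓ XP κ P p t)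
  have e2 := finrank_map_inf (rr κ k) ((XP κ P (p + 1) t).map (dd κ P))
  rw [hZ, hK] at e1
  rw [hB] at e2
  unfold hh
  omega

lemma hh_univ (p t : ℤ) : hh κ ∅ p t = hh κ Finset.univ p t := by
  rw [hh_step κ (k := 0) (by simp), hh_step κ (k := 1) (by decide), hh_step κ (k := 2) (by decide)]
  congr 1
  decide

end VD
end VD

open scoped TensorProduct

set_option maxHeartbeats 2000000
set_option synthInstance.maxHeartbeats 1000000
set_option linter.unusedSectionVars false

noncomputable section VD2

namespace VD

open Finset Module

variable {ι : Type} [LinearOrder ι] [Fintype ι] (κ : KS ι)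

open Classical in
lemma rank_restrict {J : Type} [DecidableEq J] (I I' : Set J) [Fintype I] [Fintype I'] (L : (J → ℂ) →ₗ[ℂ] (J → ℂ))
    (hL : ∀ f ∈ supp I, L f ∈ supp I') :
    finrank ℂ ↥((supp I).map L) =
      (Matrix.of fun (a : I') (b : I) => L (Pi.single b.1 1) a.1).rank := by
  have h1 : (Matrix.of fun (a : I') (b : I) => L (Pi.single b.1 1) a.1) =
      LinearMap.toMatrix' ((suppEquiv I').toLinearMap ∘ₗ (L.restrict hL) ∘ₗ
        (suppEquiv I).symm.toLinearMap) := by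
    ext a b
    rw [LinearMap.toMatrix'_apply]
    have h0 : (Pi.single b.1 1 : J → ℂ) = ((suppEquiv I).symm (Pi.single b 1)).1 := by
      funext c
      change _ = if h : c ∈ I then (Pi.single b 1 : I → ℂ) ⟨c, h⟩ else 0
      rw [Pi.single_apply]
      by_cases hc : c ∈ I
      · simp [hc, Pi.single_apply, Subtype.ext_iff]
      · have : c ≠ b.1 := by rintro rfl; exact hc b.2
        simp [hc, this]
    rw [Matrix.of_apply, h0]
    rfl
  rw [h1, Matrix.rank, ← Matrix.toLin'_apply', Matrix.toLin'_toMatrix', LinearMap.range_comp,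
    LinearEquiv.finrank_map_eq, LinearEquiv.range_comp]
  have h2 : (supp I).map L = (LinearMap.range (L.restrict hL)).map (supp I').subtype := by
    ext f
    simp only [Submodule.mem_map, LinearMap.mem_range]
    constructor
    · rintro ⟨g, hg, rfl⟩
      exact ⟨⟨L g, hL g hg⟩, ⟨⟨g, hg⟩, rfl⟩, rfl⟩
    · rintro ⟨_, ⟨g, rfl⟩, rfl⟩
      exact ⟨g.1, g.2, rfl⟩
  rw [h2]
  exact (Submodule.equivMapOfInjective _ (supp I').injective_subtype _).symm.finrank_eq

def TT : Finset ι := (Finset.univ.image κ.o)ᶜ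

lemma mem_TT {i : ι} : i ∈ TT κ ↔ ∀ k, κ.o k ≠ i := by simp [TT]

lemma card_TT : (TT κ).card + 3 = Fintype.card ι := by
  have h1 : (Finset.univ.image κ.o).card = 3 := by
    rw [Finset.card_image_of_injective _ κ.o_inj]; simp
  have h2 := Finset.card_add_card_compl (Finset.univ.image κ.o)
  unfold TT
  omega

def cc : U := Finsupp.equivFunOnFinite.symm fun _ => κ.d - 1

lemma cc_apply (k : Fin 3) : cc κ k = κ.d - 1 := rfl

lemma le_cc {u : U} : u ≤ cc κ ↔ BB κ Finset.univ u := by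
  have := κ.hd
  simp only [Finsupp.le_def, cc_apply, BB, Finset.mem_univ, true_imp_iff]
  exact forall_congr' fun k => by omega

lemma degree_cc : (cc κ).degree + 3 = 3 * κ.d := by
  have := κ.hd
  simp only [Finsupp.degree_eq_sum, Fin.sum_univ_three, cc_apply]
  omega

lemma mem_IIu {p t : ℤ} {s : Finset ι} {v : U} : (s, v) ∈ II κ Finset.univ p t ↔
    s ⊆ TT κ ∧ v ≤ cc κ ∧ (s.card : ℤ) = p ∧ (v.degree : ℤ) + p * κ.d = t := by
  rw [mem_II, le_cc]
  refine and_congr_left fun _ => ?_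
  simp only [Finset.mem_univ, true_imp_iff, Finset.subset_iff, mem_TT]
  constructor
  · rintro h x hx k rfl; exact h k hx
  · rintro h k hk; exact h hk k rfl

def star (a : Finset ι × U) : Finset ι × U := (TT κ \ a.1, cc κ - a.2)

lemma star_mem {p t p' t' : ℤ} (hp : p + p' + 3 = Fintype.card ι)
    (ht : t + t' + 3 = Fintype.card ι * κ.d) {a : Finset ι × U}
    (ha : a ∈ II κ Finset.univ p t) : star κ a ∈ II κ Finset.univ p' t' := by
  obtain ⟨s, v⟩ := a
  obtain ⟨h1, h2, h3, h4⟩ := (mem_IIu κ).1 ha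
  have e1 := card_TT κ
  have e2 := degree_cc κ
  have e3 : (TT κ \ s).card + s.card = (TT κ).card := Finset.card_sdiff_add_card_eq_card h1
  have e4 : (cc κ - v).degree + v.degree = (cc κ).degree := by
    rw [← map_add, tsub_add_cancel_of_le h2]
  have hp' : ((TT κ \ s).card : ℤ) = p' := by omega
  refine (mem_IIu κ).2 ⟨Finset.sdiff_subset, tsub_le_self, hp', ?_⟩
  have e2' : ((cc κ).degree : ℤ) + 3 = 3 * κ.d := by exact_mod_cast e2
  have e4' : ((cc κ - v).degree : ℤ) + v.degree = (cc κ).degree := by exact_mod_cast e4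
  linear_combination e4' + e2' - h4 - ht + hp * (κ.d : ℤ)

lemma star_star {p t : ℤ} {a : Finset ι × U} (ha : a ∈ II κ Finset.univ p t) :
    star κ (star κ a) = a := by
  obtain ⟨s, v⟩ := a
  obtain ⟨h1, h2, h3, h4⟩ := (mem_IIu κ).1 ha
  simp only [star, Finset.sdiff_sdiff_eq_self h1, tsub_tsub_cancel_of_le h2]

def starEquiv {p t p' t' : ℤ} (hp : p + p' + 3 = Fintype.card ι)
    (ht : t + t' + 3 = Fintype.card ι * κ.d) :
    II κ Finset.univ p t ≃ II κ Finset.univ p' t' where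
  toFun a := ⟨star κ a.1, star_mem κ hp ht a.2⟩
  invFun a := ⟨star κ a.1, star_mem κ (by linarith) (by linarith) a.2⟩
  left_inv a := Subtype.ext (star_star κ a.2)
  right_inv a := Subtype.ext (star_star κ a.2)

def tau (i : ι) : ℂ := sg i (TT κ)

def eps (s : Finset ι) : ℂ := ∏ j ∈ s, tau κ j

lemma eps_sq (s : Finset ι) : eps κ s * eps κ s = 1 := by
  unfold eps
  rw [← Finset.prod_mul_distrib]
  exact Finset.prod_eq_one fun i _ => sg_sq _ _

open Classical in
def EE (a b : Finset ι × U) : ℂ := dd κ Finset.univ (Pi.single b 1) a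

def QQ (i : ι) (a b : Finset ι × U) : Prop := i ∉ a.1 ∧ insert i a.1 = b.1 ∧ a.2 = b.2 + κ.σ i

open Classical in
lemma EE_eq {p t : ℤ} {a : Finset ι × U} (b : Finset ι × U) (ha : a ∈ II κ Finset.univ p t) :
    EE κ a b = ∑ i, if QQ κ i a b then sg i a.1 else 0 := by
  obtain ⟨s, v⟩ := a
  obtain ⟨r, u⟩ := b
  rw [EE, dd_apply, if_pos ((mem_II κ).1 ha).2.1, ← Finset.sum_subset (Finset.subset_univ (sᶜ))]
  · refine Finset.sum_congr rfl fun i hi => ?_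
    rw [Finset.mem_compl] at hi
    simp only [QQ, hi, not_false_eq_true, true_and, Pi.single_apply, Prod.mk.injEq]
    by_cases h1 : κ.σ i ≤ v
    · have : v - κ.σ i = u ↔ v = u + κ.σ i := by
        rw [tsub_eq_iff_eq_add_of_le h1]
      simp [h1, this]
    · have : ¬ (v = u + κ.σ i) := by rintro rfl; exact h1 (by simp)
      simp [h1, this]
  · intro i _ hi
    rw [if_neg]
    rintro ⟨h, _⟩
    exact hi (Finset.mem_compl.2 h)

lemma QQ_star {p t p1 t1 : ℤ} {i : ι} {a b : Finset ι × U} (ha : a ∈ II κ Finset.univ p t)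
    (hb : b ∈ II κ Finset.univ p1 t1) (h : QQ κ i a b) : QQ κ i (star κ b) (star κ a) := by
  obtain ⟨s, v⟩ := a
  obtain ⟨r, u⟩ := b
  obtain ⟨a1, a2, -, -⟩ := (mem_IIu κ).1 ha
  obtain ⟨b1, b2, -, -⟩ := (mem_IIu κ).1 hb
  obtain ⟨h1, h2, h3⟩ := h
  simp only at h1 h2 h3
  subst h2 h3
  refine ⟨?_, ?_, ?_⟩
  · simp [star]
  · have hi : i ∈ TT κ := b1 (Finset.mem_insert_self _ _)
    ext j
    simp only [star, Finset.mem_insert, Finset.mem_sdiff]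
    by_cases hj : j = i
    · subst hj; simp [hi, h1]
    · simp [hj]
  · simp only [star]
    ext k
    have := a2 k
    simp only [Finsupp.add_apply, Finsupp.tsub_apply] at *
    omega

lemma sg_union {i : ι} {s r : Finset ι} (hd : Disjoint s r) : sg i (s ∪ r) = sg i s * sg i r := by
  unfold sg
  rw [Finset.filter_union, Finset.card_union_of_disjoint (Finset.disjoint_filter_filter hd), pow_add]

lemma sign_QQ {p t p1 t1 : ℤ} {i : ι} {a b : Finset ι × U} (ha : a ∈ II κ Finset.univ p t)
    (hb : b ∈ II κ Finset.univ p1 t1) (h : QQ κ i a b) :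
    sg i a.1 = eps κ a.1 * eps κ b.1 * sg i (star κ b).1 := by
  obtain ⟨s, v⟩ := a
  obtain ⟨r, u⟩ := b
  obtain ⟨a1, a2, -, -⟩ := (mem_IIu κ).1 ha
  obtain ⟨b1, b2, -, -⟩ := (mem_IIu κ).1 hb
  obtain ⟨h1, h2, h3⟩ := h
  simp only at h1 h2 h3
  subst h2
  simp only [star]
  have e1 : eps κ (insert i s) = tau κ i * eps κ s := Finset.prod_insert h1
  have e2 : tau κ i = sg i s * sg i (TT κ \ insert i s) := by
    have : TT κ = insert i s ∪ (TT κ \ insert i s) := by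
      rw [Finset.union_sdiff_of_subset b1]
    unfold tau
    conv_lhs => rw [this]
    rw [sg_union Finset.disjoint_sdiff, sg_insert_gt (lt_irrefl i)]
  rw [e1, e2]
  have e3 := eps_sq κ s
  have e4 := sg_sq i (TT κ \ insert i s)
  linear_combination (-sg i s * sg i (TT κ \ insert i s) * sg i (TT κ \ insert i s)) * e3 - sg i s * e4

lemma EE_star {p t p1 : ℤ} {a b : Finset ι × U} (ha : a ∈ II κ Finset.univ p t)
    (hb : b ∈ II κ Finset.univ p1 t) :
    EE κ a b = eps κ a.1 * eps κ b.1 * EE κ (star κ b) (star κ a) := by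
  classical
  have ha' := star_mem κ (p' := Fintype.card ι - 3 - p) (t' := Fintype.card ι * κ.d - 3 - t)
    (by ring) (by ring) ha
  have hb' := star_mem κ (p' := Fintype.card ι - 3 - p1) (t' := Fintype.card ι * κ.d - 3 - t)
    (by ring) (by ring) hb
  rw [EE_eq κ _ ha, EE_eq κ _ hb', Finset.mul_sum]
  refine Finset.sum_congr rfl fun i _ => ?_
  have e : QQ κ i a b ↔ QQ κ i (star κ b) (star κ a) := by
    refine ⟨QQ_star κ ha hb, fun h => ?_⟩
    have := QQ_star κ hb' ha' h
    rwa [star_star κ ha, star_star κ hb] at this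
  by_cases h : QQ κ i a b
  · rw [if_pos h, if_pos (e.1 h)]
    exact sign_QQ κ ha hb h
  · rw [if_neg h, if_neg (fun h' => h (e.2 h'))]; simp

def rho (p t : ℤ) : ℕ := finrank ℂ ↥((XP κ Finset.univ p t).map (dd κ Finset.univ))

lemma rho_le {p t p' t' : ℤ} (hp : p + p' + 2 = Fintype.card ι)
    (ht : t + t' + 3 = Fintype.card ι * κ.d) : rho κ p t ≤ rho κ p' t' := by
  classical
  have hf : ∀ p t, Fintype (II κ Finset.univ p t) := fun p t => Fintype.ofFinite _
  unfold rho
  rw [rank_restrict (II κ Finset.univ p t) (II κ Finset.univ (p - 1) t) _ (fun f hf => dd_mem κ hf),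
    rank_restrict (II κ Finset.univ p' t') (II κ Finset.univ (p' - 1) t') _
      (fun f hf => dd_mem κ hf)]
  set A := (Matrix.of fun (a : II κ Finset.univ (p - 1) t) (b : II κ Finset.univ p t) =>
    (dd κ Finset.univ) (Pi.single b.1 1) a.1) with hA
  set A' := (Matrix.of fun (a : II κ Finset.univ (p' - 1) t') (b : II κ Finset.univ p' t') =>
    (dd κ Finset.univ) (Pi.single b.1 1) a.1) with hA'
  let g : II κ Finset.univ (p - 1) t ≃ II κ Finset.univ p' t' :=
    starEquiv κ (by linarith) ht
  let f : II κ Finset.univ p t ≃ II κ Finset.univ (p' - 1) t' :=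
    starEquiv κ (by linarith) ht
  let D1 : Matrix (II κ Finset.univ (p - 1) t) (II κ Finset.univ (p - 1) t) ℂ :=
    Matrix.diagonal (fun a => eps κ a.1.1)
  let D2 : Matrix (II κ Finset.univ p t) (II κ Finset.univ p t) ℂ :=
    Matrix.diagonal (fun b => eps κ b.1.1)
  have key : A = D1 * (A'.transpose.submatrix g f) * D2 := by
    ext a b
    rw [Matrix.mul_diagonal, Matrix.diagonal_mul]
    have := EE_star κ a.2 b.2
    simp only [EE] at this
    simp only [hA, hA', Matrix.of_apply, Matrix.submatrix_apply, Matrix.transpose_apply, g, f,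
      starEquiv, Equiv.coe_fn_mk]
    rw [this]; ring
  rw [key]
  refine (Matrix.rank_mul_le_left _ _).trans ((Matrix.rank_mul_le_right _ _).trans ?_)
  rw [Matrix.rank_submatrix, Matrix.rank_transpose]

lemma rho_eq {p t p' t' : ℤ} (hp : p + p' + 2 = Fintype.card ι)
    (ht : t + t' + 3 = Fintype.card ι * κ.d) : rho κ p t = rho κ p' t' :=
  le_antisymm (rho_le κ hp ht) (rho_le κ (by linarith) (by linarith))

lemma dim_eq {p t p' t' : ℤ} (hp : p + p' + 3 = Fintype.card ι)
    (ht : t + t' + 3 = Fintype.card ι * κ.d) :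
    finrank ℂ (XP κ Finset.univ p t) = finrank ℂ (XP κ Finset.univ p' t') := by
  rw [(suppEquiv _).finrank_eq, (suppEquiv _).finrank_eq]
  exact (LinearEquiv.funCongrLeft ℂ ℂ (starEquiv κ hp ht)).symm.finrank_eq

lemma hh_rho (p t : ℤ) : hh κ Finset.univ p t =
    finrank ℂ (XP κ Finset.univ p t) - rho κ p t - rho κ (p + 1) t := by
  have := finrank_map_inf (dd κ Finset.univ) (XP κ Finset.univ p t)
  unfold hh rho
  omega

theorem hh_dual {p t p' t' : ℤ} (hp : p + p' + 3 = Fintype.card ι)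
    (ht : t + t' + 3 = Fintype.card ι * κ.d) : hh κ ∅ p t = hh κ ∅ p' t' := by
  rw [hh_univ, hh_univ, hh_rho, hh_rho, dim_eq κ hp ht, rho_eq κ (p := p) (p' := p' + 1) (by linarith) ht,
    rho_eq κ (p := p + 1) (p' := p') (by linarith) ht]
  omega

theorem hh_neg {p t : ℤ} (hp : p < 0) : hh κ ∅ p t = 0 := by
  have : XP κ ∅ p t = ⊥ := by
    rw [eq_bot_iff]
    intro f hf
    rw [Submodule.mem_bot]
    funext ⟨s, v⟩
    by_contra h
    have := ((mem_II κ).1 (ne_mem hf h)).2.2.1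
    omega
  have e : finrank ℂ ↥(LinearMap.ker (dd κ ∅) ⊓ XP κ ∅ p t) = 0 := by
    rw [this, inf_bot_eq]; exact finrank_bot _ _
  unfold hh
  rw [e, Nat.zero_sub]

end VD
end VD2

open scoped TensorProduct

set_option maxHeartbeats 2000000
set_option synthInstance.maxHeartbeats 1000000
set_option linter.unusedSectionVars false

noncomputable section VD3

namespace VD

open Finset Module

/-- exponents of degree `e` -/
abbrev Mon (e : ℤ) : Type := {u : U // (u.degree : ℤ) = e}

instance (e : ℤ) : Finite (Mon e) := by
  refine Set.Finite.subset (Finset.finsuppAntidiag (Finset.univ : Finset (Fin 3))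
      e.toNat).finite_toSet ?_
  intro u hu
  have hu : (u.degree : ℤ) = e := hu
  have h2 : u.degree = e.toNat := by omega
  simp [Finset.mem_finsuppAntidiag, ← h2, Finsupp.degree_eq_sum]

instance (e : ℤ) : Fintype (Mon e) := Fintype.ofFinite _

lemma mem_Sdeg {e : ℤ} {f : PolyC 3} : f ∈ Sdeg 3 e ↔ ∀ u, f.coeff u ≠ 0 → (u.degree : ℤ) = e := by
  unfold Sdeg
  split_ifs with h
  · rw [MvPolynomial.mem_homogeneousSubmodule]
    unfold MvPolynomial.IsHomogeneous MvPolynomial.IsWeightedHomogeneous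
    refine forall_congr' fun u => ?_
    have hw : Finsupp.weight (1 : Fin 3 → ℕ) u = u.degree := by
      rw [Finsupp.degree_eq_weight_one]
      rfl
    rw [hw]
    refine ⟨fun h1 h2 => ?_, fun h1 h2 => ?_⟩
    · have := h1 h2; omega
    · have := h1 h2; omega
  · rw [Submodule.mem_bot]
    constructor
    · rintro rfl u hu
      simp at hu
    · intro h1
      ext u
      by_contra h2
      have := h1 u (by simpa using h2)
      omega

lemma mono_mem {e : ℤ} {u : U} (h : (u.degree : ℤ) = e) : monoC 3 u ∈ Sdeg 3 e := by
  rw [mem_Sdeg]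
  intro v hv
  unfold monoC at hv
  rw [MvPolynomial.coeff_monomial] at hv
  split_ifs at hv with h1
  · rw [← h1]; exact h
  · exact absurd rfl hv

def mon (e : ℤ) (u : Mon e) : Sdeg 3 e := ⟨monoC 3 u.1, mono_mem u.2⟩

/-- monomial basis -/
def bS (e : ℤ) : Basis (Mon e) ℂ (Sdeg 3 e) := by
  refine Basis.mk (v := mon e) ?_ ?_
  · apply LinearIndependent.of_comp (Sdeg 3 e).subtype
    have h := (MvPolynomial.basisMonomials (Fin 3) ℂ).linearIndependent
    have h2 := h.comp (fun u : Mon e => u.1) Subtype.val_injective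
    have h3 : (⇑(Sdeg 3 e).subtype ∘ mon e) =
        (⇑(MvPolynomial.basisMonomials (Fin 3) ℂ) ∘ fun u : Mon e => u.1) := by
      funext u
      simp [mon, monoC]
    rw [h3]
    exact h2
  · rintro ⟨f, hf⟩ -
    have hf' := mem_Sdeg.1 hf
    have h3 : (⟨f, hf⟩ : Sdeg 3 e) = ∑ u : Mon e, f.coeff u.1 • mon e u := by
      apply Subtype.ext
      rw [AddSubmonoidClass.coe_finsetSum]
      apply MvPolynomial.ext
      intro v
      rw [MvPolynomial.coeff_sum]
      simp only [Submodule.coe_smul, mon, monoC, MvPolynomial.coeff_smul,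
        MvPolynomial.coeff_monomial, smul_eq_mul, mul_ite, mul_one, mul_zero]
      by_cases hv : (v.degree : ℤ) = e
      · rw [Finset.sum_eq_single ⟨v, hv⟩]
        · simp
        · intro u _ hu
          rw [if_neg]
          rintro rfl; exact hu rfl
        · simp
      · rw [Finset.sum_eq_zero]
        · by_contra h; exact hv (hf' v h)
        · intro u _
          rw [if_neg]
          rintro rfl; exact hv u.2
    rw [h3]
    exact Submodule.sum_mem _ fun u _ => Submodule.smul_mem _ _ (Submodule.subset_span ⟨u, rfl⟩)

lemma bS_apply (e : ℤ) (u : Mon e) : bS e u = mon e u := by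
  unfold bS; rw [Basis.mk_apply]

/-- variables of the Koszul complex -/
def Idx (d : ℕ) : Type := Mon (d : ℤ)

instance (d : ℕ) : Fintype (Idx d) := inferInstanceAs (Fintype (Mon (d : ℤ)))

instance (d : ℕ) : LinearOrder (Idx d) := LinearOrder.lift' (Fintype.equivFin (Idx d))
  (Fintype.equivFin (Idx d)).injective

lemma card_Idx (d : ℕ) : Fintype.card (Idx d) = (d + 2).choose 2 := by
  have e : Idx d ≃ (Finset.finsuppAntidiag (Finset.univ : Finset (Fin 3)) d) := by
    refine Equiv.subtypeEquivRight fun u => ?_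
    simp [Finset.mem_finsuppAntidiag, Finsupp.degree_eq_sum]
    norm_cast
  rw [Fintype.card_congr e, Fintype.card_coe, Finset.card_finsuppAntidiag_nat_eq_choose]
  simp only [Finset.card_univ, Fintype.card_fin]
  have : 3 + d - 1 = d + 2 := by omega
  rw [this, ← Nat.choose_symm_add]

def kap (d : ℕ) (hd : 0 < d) : KS (Idx d) where
  d := d
  hd := hd
  σ i := i.1
  o k := ⟨Finsupp.single k d, by simp⟩
  o_inj := by
    intro k l h
    have h1 : (Finsupp.single k d : U) = Finsupp.single l d := congrArg Subtype.val h
    rcases (Finsupp.single_eq_single_iff _ _ _ _).1 h1 with h2 | h2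
    · exact h2.1
    · omega
  hσ i := by have := i.2; exact_mod_cast this
  ho k := rfl

/-- The differential of a basis vector of the model. -/
lemma dd_single {ι : Type} [LinearOrder ι] [Fintype ι] (κ : KS ι) (s : Finset ι) (u : U) :
    dd κ ∅ (Pi.single (s, u) 1) =
      ∑ i ∈ s, sg i (s.erase i) • (Pi.single (s.erase i, u + κ.σ i) 1 : XX ι) := by
  classical
  funext ⟨r, v⟩
  rw [dd_apply, if_pos (by simp [BB]), Finset.sum_apply]
  have L : ∀ (A : Finset ι) (F : ι → ℂ), ∑ i ∈ A, F i = ∑ i, if i ∈ A then F i else 0 := by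
    intro A F; simp [Finset.sum_ite_mem]
  rw [L rᶜ, L s]
  refine Finset.sum_congr rfl fun i _ => ?_
  simp only [Finset.mem_compl, Pi.smul_apply, smul_eq_mul, Pi.single_apply, Prod.mk.injEq]
  by_cases h : i ∉ r ∧ insert i r = s ∧ v = u + κ.σ i
  · obtain ⟨h1, h2, h3⟩ := h
    subst h2 h3
    simp [h1]
  · have e1 : ¬ (i ∈ s ∧ r = s.erase i ∧ v = u + κ.σ i) := by
      rintro ⟨h1, rfl, h3⟩
      exact h ⟨Finset.notMem_erase _ _, Finset.insert_erase h1, h3⟩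
    have e2 : ¬ (i ∉ r ∧ κ.σ i ≤ v ∧ insert i r = s ∧ v - κ.σ i = u) := by
      rintro ⟨h1, h2, h3, h4⟩
      exact h ⟨h1, h3, by rw [← h4, tsub_add_cancel_of_le h2]⟩
    have g1 : (if i ∈ s then sg i (s.erase i) * (if r = s.erase i ∧ v = u + κ.σ i then (1 : ℂ) else 0)
        else 0) = 0 := by
      split_ifs with a b
      · exact absurd ⟨a, b⟩ e1
      · simp
      · rfl
    rw [g1]
    split_ifs with a b c
    · rfl
    · exact absurd ⟨a, b, c⟩ e2
    · simp
    · rfl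

/-- index of the basis of the Koszul module -/
abbrev KI (d p : ℕ) (e : ℤ) : Type := Set.powersetCard (Idx d) p × Mon e

def bI (d : ℕ) : Basis (Idx d) ℂ (Sdeg 3 (d : ℤ)) := bS (d : ℤ)

lemma bI_apply (d : ℕ) (i : Idx d) : bI d i = mon (d : ℤ) i := bS_apply _ _

lemma sum_orderEmb {ι M : Type*} [LinearOrder ι] [AddCommMonoid M] {s : Finset ι} {p : ℕ}
    (hs : s.card = p) (F : ι → M) : ∑ j ∈ s, F j = ∑ k : Fin p, F (s.orderEmbOfFin hs k) := by
  conv_lhs => rw [← Finset.map_orderEmbOfFin_univ s hs]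
  rw [Finset.sum_map]
  rfl

def BK (d p : ℕ) (e : ℤ) : Basis (KI d p e) ℂ (KosModule 3 (d : ℤ) p e) :=
  Basis.tensorProduct (Basis.exteriorPower (I := Idx d) p (bI d)) (bS e)

lemma BK_apply (d p : ℕ) (e : ℤ) (x : KI d p e) : BK d p e x =
    wedgeE ℂ (Sdeg 3 (d : ℤ)) p (fun j => mon (d : ℤ) (Finset.orderEmbOfFin x.1.1 x.1.2 j)) ⊗ₜ[ℂ]
      mon e x.2 := by
  rw [BK, Basis.tensorProduct_apply, bS_apply, exteriorPower.basis_apply]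
  congr 1
  unfold exteriorPower.ιMulti_family wedgeE
  apply Subtype.ext
  rw [exteriorPower.ιMulti_apply_coe]
  simp only
  congr 1
  funext j
  simp only [Function.comp_apply]
  exact bI_apply d _

def idxEquiv {d : ℕ} (hd : 0 < d) {p : ℕ} {e t : ℤ} (h : e + p * d = t) :
    II (kap d hd) ∅ (p : ℤ) t ≃ KI d p e where
  toFun a := (⟨a.1.1, by
      have := a.2.2.2.1
      exact_mod_cast this⟩, ⟨a.1.2, by
      have h2 : ((a.1.2).degree : ℤ) + p * d = t := a.2.2.2.2
      linarith⟩)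
  invFun x := ⟨(x.1.1, x.2.1), by simp, by simp [BB], by
      have : x.1.1.card = p := x.1.2
      exact_mod_cast this, by
      have h2 : ((x.2.1).degree : ℤ) = e := x.2.2
      change ((x.2.1).degree : ℤ) + p * d = t
      linarith⟩
  left_inv a := rfl
  right_inv x := rfl

def Psi {d : ℕ} (hd : 0 < d) {p : ℕ} {e t : ℤ} (h : e + p * d = t) :
    KosModule 3 (d : ℤ) p e ≃ₗ[ℂ] XP (kap d hd) ∅ (p : ℤ) t :=
  (BK d p e).equivFun.trans
    ((LinearEquiv.funCongrLeft ℂ ℂ (idxEquiv hd h)).trans (suppEquiv _).symm)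

lemma Psi_BK {d : ℕ} (hd : 0 < d) {p : ℕ} {e t : ℤ} (h : e + p * d = t) (x : KI d p e) :
    (Psi hd h (BK d p e x)).1 = Pi.single (x.1.1, x.2.1) 1 := by
  classical
  funext a
  have h1 : (Psi hd h (BK d p e x)).1 a = if h' : a ∈ II (kap d hd) ∅ (p : ℤ) t then
      (BK d p e).equivFun (BK d p e x) (idxEquiv hd h ⟨a, h'⟩) else 0 := rfl
  rw [h1, Pi.single_apply]
  by_cases ha : a ∈ II (kap d hd) ∅ (p : ℤ) t
  · rw [dif_pos ha, Basis.equivFun_self]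
    refine if_congr ?_ rfl rfl
    rw [eq_comm, ← Equiv.eq_symm_apply, Subtype.ext_iff]
    rfl
  · rw [dif_neg ha, if_neg]
    rintro rfl
    exact ha ((idxEquiv hd h).symm x).2

lemma card_below {ι : Type} [LinearOrder ι] {s : Finset ι} {p : ℕ} (hs : s.card = p) (k : Fin p) :
    ((s.erase (s.orderEmbOfFin hs k)).filter (· < s.orderEmbOfFin hs k)).card = k := by
  have : (s.erase (s.orderEmbOfFin hs k)).filter (· < s.orderEmbOfFin hs k) =
      (Finset.Iio k).map (s.orderEmbOfFin hs).toEmbedding := by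
    ext i
    simp only [Finset.mem_filter, Finset.mem_erase, Finset.mem_map, Finset.mem_Iio]
    constructor
    · rintro ⟨⟨_, h2⟩, h3⟩
      have : i ∈ Set.range (s.orderEmbOfFin hs) := by
        rw [Finset.range_orderEmbOfFin]; exact h2
      obtain ⟨j, rfl⟩ := this
      exact ⟨j, by simpa using h3, rfl⟩
    · rintro ⟨j, hj, rfl⟩
      have h1 : s.orderEmbOfFin hs j < s.orderEmbOfFin hs k := by simpa using hj
      exact ⟨⟨h1.ne, Finset.orderEmbOfFin_mem _ _ _⟩, h1⟩
  rw [this, Finset.card_map, Fin.card_Iio]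

/-- incl is injective -/
lemma incl_inj (d p : ℕ) (e : ℤ) : Function.Injective
    (TensorProduct.map (LinearMap.id (R := ℂ) (M := ↥(⋀[ℂ]^p ↥(Sdeg 3 (d : ℤ)))))
      (Sdeg 3 e).subtype) :=
  Module.Flat.lTensor_preserves_injective_linearMap (M := ↥(⋀[ℂ]^p ↥(Sdeg 3 (d : ℤ))))
    (Sdeg 3 e).subtype (Sdeg 3 e).injective_subtype

lemma D_BK {d p : ℕ} {e e' : ℤ} (he : e' = e + d)
    {D : KosModule 3 (d : ℤ) (p + 1) e →ₗ[ℂ] KosModule 3 (d : ℤ) p e'}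
    (hD : IsKoszulDiff 3 (d : ℤ) e e' p D) (x : KI d (p + 1) e) (i : Fin (p + 1) → Idx d)
    (hi : i = Finset.orderEmbOfFin x.1.1 x.1.2)
    (y : Fin (p + 1) → KI d p e')
    (hy1 : ∀ k, (y k).1.1 = x.1.1.erase (i k)) (hy2 : ∀ k, (y k).2.1 = x.2.1 + (i k).1) :
    D (BK d (p + 1) e x) = ∑ k : Fin (p + 1), ((-1 : ℂ) ^ ((k : ℕ) + 1)) • BK d p e' (y k) := by
  apply incl_inj
  rw [BK_apply, hD, map_sum]
  refine Finset.sum_congr rfl fun k _ => ?_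
  rw [map_smul, BK_apply, TensorProduct.map_tmul, LinearMap.id_apply]
  congr 2
  · congr 1
    funext j
    congr 1
    have := Finset.orderEmbOfFin_unique (s := (y k).1.1) (y k).1.2
      (f := fun j => x.1.1.orderEmbOfFin x.1.2 (k.succAbove j)) ?_ ?_
    · exact congrFun this j
    · intro j
      rw [hy1, Finset.mem_erase, hi]
      refine ⟨?_, Finset.orderEmbOfFin_mem _ _ _⟩
      intro h
      exact Fin.succAbove_ne k j ((x.1.1.orderEmbOfFin x.1.2).injective h)
    · intro a b hab
      exact (x.1.1.orderEmbOfFin x.1.2).strictMono (Fin.strictMono_succAbove k hab)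
  · simp only [mon, monoC, Submodule.subtype_apply]
    rw [MvPolynomial.monomial_mul, hy2, hi, add_comm, one_mul]

lemma Psi_comm {d : ℕ} (hd : 0 < d) {p : ℕ} {e e' t : ℤ} (he : e' = e + d)
    (h : e + ((p + 1 : ℕ) : ℤ) * d = t) (h' : e' + p * d = t)
    {D : KosModule 3 (d : ℤ) (p + 1) e →ₗ[ℂ] KosModule 3 (d : ℤ) p e'}
    (hD : IsKoszulDiff 3 (d : ℤ) e e' p D) (z : KosModule 3 (d : ℤ) (p + 1) e) :
    dd (kap d hd) ∅ (Psi hd h z).1 = - (Psi hd h' (D z)).1 := by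
  have key : (dd (kap d hd) ∅) ∘ₗ (Submodule.subtype _) ∘ₗ (Psi hd h).toLinearMap =
      - ((Submodule.subtype _) ∘ₗ (Psi hd h').toLinearMap ∘ₗ D) := by
    apply (BK d (p + 1) e).ext
    intro x
    have hc : x.1.1.card = p + 1 := x.1.2
    let i : Fin (p + 1) → Idx d := Finset.orderEmbOfFin x.1.1 x.1.2
    let y : Fin (p + 1) → KI d p e' := fun k => (⟨x.1.1.erase (i k), by
      have h1 : i k ∈ x.1.1 := Finset.orderEmbOfFin_mem _ _ _
      have h2 : (x.1.1.erase (i k)).card = p := by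
        rw [Finset.card_erase_of_mem h1, hc]; rfl
      exact h2⟩, ⟨x.2.1 + (i k).1, by
      have h1 := x.2.2
      have h2 := (i k).2
      rw [map_add]; push_cast; rw [h1, h2, he]⟩)
    change dd (kap d hd) ∅ (Psi hd h (BK d (p + 1) e x)).1 =
      - (Psi hd h' (D (BK d (p + 1) e x))).1
    rw [Psi_BK, dd_single, D_BK he hD x i rfl y (fun _ => rfl) (fun _ => rfl), map_sum,
      AddSubmonoidClass.coe_finsetSum, ← Finset.sum_neg_distrib]
    rw [sum_orderEmb hc]
    refine Finset.sum_congr rfl fun k _ => ?_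
    rw [map_smul, Submodule.coe_smul, Psi_BK]
    have hs : sg (i k) (x.1.1.erase (i k)) = (-1) ^ (k : ℕ) := by
      unfold sg
      exact congrArg _ (card_below hc k)
    change sg (i k) (x.1.1.erase (i k)) • _ = _
    rw [hs, ← neg_smul]
    congr 1
    ring
  exact LinearMap.congr_fun key z

end VD
end VD3

open scoped TensorProduct

set_option maxHeartbeats 2000000
set_option synthInstance.maxHeartbeats 1000000

noncomputable section VD4

namespace VD

open Finset Module

section generic

variable {V V1 X : Type*} [AddCommMonoid V] [Module ℂ V] [AddCommMonoid V1] [Module ℂ V1]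
  [AddCommGroup X] [Module ℂ X] {δ : X →ₗ[ℂ] X} {A A1 : Submodule ℂ X}

lemma range_eq (Ψ : V ≃ₗ[ℂ] A) (Ψ1 : V1 ≃ₗ[ℂ] A1) {D : V1 →ₗ[ℂ] V}
    (h : ∀ z, δ (Ψ1 z).1 = - (Ψ (D z)).1) :
    finrank ℂ (LinearMap.range D) = finrank ℂ (A1.map δ) := by
  have hj : Function.Injective (A.subtype ∘ₗ Ψ.toLinearMap) :=
    A.injective_subtype.comp Ψ.injective
  rw [LinearEquiv.finrank_eq (Submodule.equivMapOfInjective _ hj (LinearMap.range D))]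
  congr 2
  all_goals
    ext y
    simp only [Submodule.mem_map, LinearMap.mem_range]
    constructor
    · rintro ⟨_, ⟨z, rfl⟩, rfl⟩
      refine ⟨(Ψ1 ((-1 : ℂ) • z)).1, (Ψ1 ((-1 : ℂ) • z)).2, ?_⟩
      rw [h]
      simp
    · rintro ⟨a, ha, rfl⟩
      refine ⟨_, ⟨(-1 : ℂ) • (Ψ1.symm ⟨a, ha⟩), rfl⟩, ?_⟩
      have := h (Ψ1.symm ⟨a, ha⟩)
      rw [LinearEquiv.apply_symm_apply] at this
      rw [this]
      simp

lemma ker_eq (Ψ : V ≃ₗ[ℂ] A) (Ψ1 : V1 ≃ₗ[ℂ] A1) {D : V1 →ₗ[ℂ] V}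
    (h : ∀ z, δ (Ψ1 z).1 = - (Ψ (D z)).1) :
    finrank ℂ (LinearMap.ker D) = finrank ℂ ↥(LinearMap.ker δ ⊓ A1) := by
  have hj : Function.Injective (A1.subtype ∘ₗ Ψ1.toLinearMap) :=
    A1.injective_subtype.comp Ψ1.injective
  rw [LinearEquiv.finrank_eq (Submodule.equivMapOfInjective _ hj (LinearMap.ker D))]
  congr 2
  all_goals
    ext y
    simp only [Submodule.mem_map, LinearMap.mem_ker, Submodule.mem_inf]
    constructor
    · rintro ⟨z, hz, rfl⟩
      refine ⟨?_, (Ψ1 z).2⟩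
      change δ (Ψ1 z).1 = 0
      rw [h, hz]
      simp
    · rintro ⟨ha, hb⟩
      refine ⟨Ψ1.symm ⟨y, hb⟩, ?_, ?_⟩
      · have := h (Ψ1.symm ⟨y, hb⟩)
        rw [LinearEquiv.apply_symm_apply, ha] at this
        have h2 : (Ψ (D (Ψ1.symm ⟨y, hb⟩))).1 = 0 := by
          rw [← neg_eq_zero]; exact this.symm
        have h3 : Ψ (D (Ψ1.symm ⟨y, hb⟩)) = 0 := Subtype.ext h2
        simpa using h3
      · simp

end generic

section koszul

variable {d : ℕ} (hd : 0 < d) {p : ℕ} {e e' e'' : ℤ} (t : ℤ)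
    {D : KosModule 3 (d : ℤ) (p + 1) e →ₗ[ℂ] KosModule 3 (d : ℤ) p e'}
    {D' : KosModule 3 (d : ℤ) (p + 1 + 1) e'' →ₗ[ℂ] KosModule 3 (d : ℤ) (p + 1) e}

lemma rangeD (he : e' = e + d) (h' : e' + p * d = t) (hD : IsKoszulDiff 3 (d : ℤ) e e' p D) :
    finrank ℂ (LinearMap.range D) =
      finrank ℂ ((XP (kap d hd) ∅ ((p : ℤ) + 1) t).map (dd (kap d hd) ∅)) := by
  have h : e + ((p + 1 : ℕ) : ℤ) * d = t := by rw [← h', he]; push_cast; ring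
  exact range_eq (Psi hd h') (Psi hd h) (Psi_comm hd he h h' hD)

lemma kerD (he : e' = e + d) (h : e + ((p + 1 : ℕ) : ℤ) * d = t)
    (hD : IsKoszulDiff 3 (d : ℤ) e e' p D) :
    finrank ℂ (LinearMap.ker D) =
      finrank ℂ ↥(LinearMap.ker (dd (kap d hd) ∅) ⊓ XP (kap d hd) ∅ ((p + 1 : ℕ) : ℤ) t) := by
  have h' : e' + p * d = t := by rw [← h, he]; push_cast; ring
  exact ker_eq (Psi hd h') (Psi hd h) (Psi_comm hd he h h' hD)

lemma DD (hd : 0 < d) (he : e' = e + d) (he2 : e = e'' + d)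
    (hD : IsKoszulDiff 3 (d : ℤ) e e' p D) (hD' : IsKoszulDiff 3 (d : ℤ) e'' e (p + 1) D') :
    LinearMap.range D' ≤ LinearMap.ker D := by
  rintro _ ⟨z, rfl⟩
  rw [LinearMap.mem_ker]
  have h : e + ((p + 1 : ℕ) : ℤ) * d = e' + p * d := by rw [he]; push_cast; ring
  have h2 : e'' + ((p + 1 + 1 : ℕ) : ℤ) * d = e' + p * d := by rw [he, he2]; push_cast; ring
  have c1 := Psi_comm hd he h rfl hD (D' z)
  have c2 := Psi_comm hd he2 h2 h hD' z
  rw [← neg_eq_iff_eq_neg] at c2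
  rw [← c2, map_neg, dd_sq, neg_zero, eq_comm, neg_eq_zero] at c1
  have h3 : Psi hd (e := e') (p := p) rfl (D (D' z)) = 0 := Subtype.ext c1
  exact (LinearEquiv.map_eq_zero_iff _).1 h3

lemma zeroD (h : e = t) : finrank ℂ (KosModule 3 (d : ℤ) 0 e) =
    finrank ℂ ↥(LinearMap.ker (dd (kap d hd) ∅) ⊓ XP (kap d hd) ∅ ((0 : ℕ) : ℤ) t) := by
  have h1 : LinearMap.ker (dd (kap d hd) ∅) ⊓ XP (kap d hd) ∅ ((0 : ℕ) : ℤ) t =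
      XP (kap d hd) ∅ ((0 : ℕ) : ℤ) t := by
    rw [inf_eq_right]
    intro f hf
    have h1 := dd_mem (kap d hd) hf
    rw [LinearMap.mem_ker]
    funext ⟨s, v⟩
    by_contra h
    have := (mem_II _).1 (ne_mem h1 h)
    have h2 := this.2.2.1
    omega
  rw [h1]
  exact LinearEquiv.finrank_eq (Psi hd (by rw [← h]; push_cast; ring))

end koszul

lemma Kdim_eq {d : ℕ} (hd : 0 < d) {D : KFam 3 (d : ℤ)} (hD : IsKoszulFam 3 (d : ℤ) D) (b : ℤ)
    (p : ℕ) (q : ℤ) : Kdim 3 (d : ℤ) D b p q = hh (kap d hd) ∅ (p : ℤ) (b + (q + p) * d) := by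
  cases p with
  | zero =>
    exact congrArg₂ (· - ·) (zeroD hd (b + (q + (0 : ℕ)) * d) (by push_cast; ring))
      (rangeD hd (b + (q + (0 : ℕ)) * d) (by ring) (by push_cast; ring)
        (hD 0 (b + (q - 1) * d) (b + q * d) (by ring)))
  | succ p =>
    have hle := DD hd (by ring) (by ring) (hD p (b + q * d) (b + (q + 1) * d) (by ring))
      (hD (p + 1) (b + (q - 1) * d) (b + q * d) (by ring))
    have h1 := rangeD hd (b + (q + (p + 1 : ℕ)) * d) (by ring) (by push_cast; ring)
        (hD (p + 1) (b + (q - 1) * d) (b + q * d) (by ring))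
    rw [← inf_eq_left.2 hle] at h1
    exact congrArg₂ (· - ·) (kerD hd (b + (q + (p + 1 : ℕ)) * d) (by ring) (by push_cast; ring)
        (hD p (b + q * d) (b + (q + 1) * d) (by ring))) h1

lemma Kdim_dual {d : ℕ} (hd : 0 < d) {D : KFam 3 (d : ℤ)} (hD : IsKoszulFam 3 (d : ℤ) D) (b : ℤ)
    (hb : b + 3 = d) (N : ℕ) (hN : N + 3 = (d + 2).choose 2) (p : ℕ) (q : ℤ) :
    Kdim 3 (d : ℤ) D b p q = if p ≤ N then Kdim 3 (d : ℤ) D 0 (N - p) (2 - q) else 0 := by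
  have hN' : (Fintype.card (Idx d) : ℤ) = N + 3 := by rw [card_Idx, ← hN]; push_cast; rfl
  have hk : (kap d hd).d = d := rfl
  rw [Kdim_eq hd hD]
  rw [hh_dual (kap d hd) (p' := (N : ℤ) - p) (t' := 0 + ((2 - q) + ((N : ℤ) - p)) * d)
    (by rw [hN']; ring) (by rw [hN', hk]; linear_combination hb)]
  split_ifs with h
  · rw [Kdim_eq hd hD, Nat.cast_sub h]
  · exact hh_neg _ (by omega)

end VD
end VD4

/-- Duality instances for Veronese syzygies of `ℙ²`:
`dim K_{p,q}(ℙ²,2;5) = dim K_{18-p,2-q}(ℙ²,0;5)` with `18 = C(7,2) - 3`, and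
`dim K_{p,q}(ℙ²,1;4) = dim K_{12-p,2-q}(ℙ²,0;4)` with `12 = C(6,2) - 3`
(the right-hand side being `0` when `18 - p`, resp. `12 - p`, would be negative). -/
theorem veronese_duality_instances
    (D5 : KFam 3 5) (hD5 : IsKoszulFam 3 5 D5)
    (D4 : KFam 3 4) (hD4 : IsKoszulFam 3 4 D4) :
    (18 = Nat.choose 7 2 - 3) ∧
    (∀ (p : ℕ) (q : ℤ),
      Kdim 3 5 D5 2 p q = if p ≤ 18 then Kdim 3 5 D5 0 (18 - p) (2 - q) else 0) ∧
    (12 = Nat.choose 6 2 - 3) ∧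
    (∀ (p : ℕ) (q : ℤ),
      Kdim 3 4 D4 1 p q = if p ≤ 12 then Kdim 3 4 D4 0 (12 - p) (2 - q) else 0) := by
  refine ⟨by decide, fun p q => ?_, by decide, fun p q => ?_⟩
  · exact VD.Kdim_dual (d := 5) (by norm_num) (D := D5) hD5 2 (by norm_num) 18 (by decide) p q
  · exact VD.Kdim_dual (d := 4) (by norm_num) (D := D4) hD4 1 (by norm_num) 12 (by decide) p q
end
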